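/- For every integer l ≥ 1 there exists a constant C > 0, depending only on Ω, r, u, κ and l, such that for every f ∈ C^∞ on the closure of Ω: ‖f‖_{H^{2l, 1/(2κ)+l-1/2}} ≤ C ‖(A + I) f‖_{H^{2l-2, 1/(2κ)+l-3/2}}, where I is the identity operator. -/

import Mathlib

open Set MeasureTheory

/-- Partial derivative in the `i`-th coordinate direction. -/
noncomputable def pd {n : ℕ} (i : Fin n) (f : (Fin n → ℝ) → ℝ) : (Fin n → ℝ) → ℝ :=
  fun x => fderiv ℝ f x (Pi.single i 1)

/-- Iterated partial derivative `∂^β f` for an (ordered) multi-index `β` of length `k`. -/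
noncomputable def mderiv {n k : ℕ} (β : Fin k → Fin n) (f : (Fin n → ℝ) → ℝ) :
    (Fin n → ℝ) → ℝ :=
  (List.ofFn β).foldr pd f

/-- `Ω` has a smooth boundary: it is the superlevel set of a smooth defining function whose
gradient does not vanish on the boundary. -/
def HasSmoothBoundary {n : ℕ} (Ω : Set (Fin n → ℝ)) : Prop :=
  ∃ ρ : (Fin n → ℝ) → ℝ, ContDiff ℝ (⊤ : ℕ∞) ρ ∧ Ω = {x | 0 < ρ x} ∧
    ∀ x ∈ frontier Ω, ρ x = 0 ∧ fderiv ℝ ρ x ≠ 0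

/-- The matrix field `H^{ij} = δ^{ij} - u^i u^j / (u^0)²`. -/
noncomputable def Hcoef (u : (Fin 3 → ℝ) → Fin 4 → ℝ) (i j : Fin 3)
    (x : Fin 3 → ℝ) : ℝ :=
  (if i = j then (1:ℝ) else 0) - u x i.succ * u x j.succ / (u x 0) ^ 2

/-- The degenerate elliptic operator
`L̃₁ f = (κ+1) H^{ij} (r ∂_i ∂_j f + (1/κ)(∂_i r)(∂_j f))`. -/
noncomputable def L1t (κ : ℝ) (r : (Fin 3 → ℝ) → ℝ) (u : (Fin 3 → ℝ) → Fin 4 → ℝ)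
    (f : (Fin 3 → ℝ) → ℝ) (x : Fin 3 → ℝ) : ℝ :=
  (κ + 1) * ∑ i, ∑ j, Hcoef u i j x *
    (r x * pd i (pd j f) x + (1/κ) * pd i r x * pd j f x)

/-- The weighted elliptic operator (up to sign, `L̂₁` of the paper)
`A f = -(κ+1) r^{1-1/κ} ∂_i (r^{1/κ} H^{ij} ∂_j f)`. -/
noncomputable def Aop (κ : ℝ) (r : (Fin 3 → ℝ) → ℝ) (u : (Fin 3 → ℝ) → Fin 4 → ℝ)
    (f : (Fin 3 → ℝ) → ℝ) (x : Fin 3 → ℝ) : ℝ :=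
  -(κ + 1) * r x ^ ((1:ℝ) - 1/κ) *
    ∑ i, pd i (fun y => r y ^ (1/κ) * ∑ j, Hcoef u i j y * pd j f y) x

/-- The weighted Sobolev norm with weight `r`:
`‖f‖_{H^{j,σ}}² = Σ_{|β| ≤ j} ∫_Ω r^{2σ} |∂^β f|² dx`. -/
noncomputable def rSobNorm (Ω : Set (Fin 3 → ℝ)) (r : (Fin 3 → ℝ) → ℝ) (j : ℕ) (σ : ℝ)
    (f : (Fin 3 → ℝ) → ℝ) : ℝ :=
  Real.sqrt (∑ k ∈ Finset.range (j + 1), ∑ β : Fin k → Fin 3,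
    ∫ x in Ω, r x ^ (2 * σ) * (mderiv β f x) ^ 2)

/-- A commutative algebra of bounded functions on `X` with commuting derivations, a boundary
defining element `r`, an elliptic matrix `G` and a family of weighted integrals
`I p g = ∫ r ^ p * g` which satisfy integration by parts without boundary terms. -/
structure WeightedCalculus (S X ι : Type*) [CommRing S] [Algebra ℝ S] [Fintype ι] where
  ev : X → S →ₐ[ℝ] ℝ
  bdd : ∀ g : S, ∃ C : ℝ, ∀ x, |ev x g| ≤ C
  d : ι → Derivation ℝ S S
  d_comm : ∀ i j f, d i (d j f) = d j (d i f)
  r : S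
  r_nonneg : ∀ x, 0 ≤ ev x r
  I : ℝ → S →ₗ[ℝ] ℝ
  I_nonneg : ∀ p, -1 < p → ∀ g : S, (∀ x, 0 ≤ ev x g) → 0 ≤ I p g
  I_mul_r : ∀ p, -1 < p → ∀ g : S, I p (r * g) = I (p + 1) g
  I_parts : ∀ p, -1 < p → ∀ i g, I (p + 1) (d i g) = -(p + 1) * I p (d i r * g)
  grad_r : ∃ c > 0, ∀ x, c ≤ ev x r + ∑ i, ev x (d i r) ^ 2
  G : ι → ι → S
  G_symm : ∀ i j, G i j = G j i
  G_elliptic : ∃ c > 0, ∀ x (ξ : ι → ℝ), c * ∑ i, ξ i ^ 2 ≤ ∑ i, ∑ j, ev x (G i j) * ξ i * ξ j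

namespace WeightedCalculus

variable {S X ι : Type*} [CommRing S] [Algebra ℝ S] [Fintype ι] (W : WeightedCalculus S X ι)

lemma I_mono {p : ℝ} (hp : -1 < p) {g h : S} (H : ∀ x, W.ev x g ≤ W.ev x h) :
    W.I p g ≤ W.I p h := by
  have := W.I_nonneg p hp (h - g) (fun x => by simpa using H x)
  simpa using this

lemma I_sq_nonneg {p : ℝ} (hp : -1 < p) (g : S) : 0 ≤ W.I p (g ^ 2) :=
  W.I_nonneg p hp _ fun x => by simpa using sq_nonneg _

lemma I_mul_r_sq {p : ℝ} (hp : -1 < p) (g : S) : W.I p (W.r ^ 2 * g) = W.I (p + 2) g := by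
  rw [pow_two, mul_assoc, W.I_mul_r p hp, W.I_mul_r (p + 1) (by linarith)]
  congr 2; ring

lemma exists_bound (a : S) : ∃ M > 0, ∀ x, |W.ev x a| ≤ M := by
  obtain ⟨C, hC⟩ := W.bdd a
  exact ⟨max C 1, by positivity, fun x => (hC x).trans (le_max_left _ _)⟩

lemma I_sq_mul_le (a : S) {p : ℝ} (hp : -1 < p) :
    ∃ C ≥ 0, ∀ g, W.I p ((a * g) ^ 2) ≤ C * W.I p (g ^ 2) := by
  obtain ⟨M, hM, h⟩ := W.exists_bound a
  refine ⟨M ^ 2, by positivity, fun g => ?_⟩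
  rw [← smul_eq_mul (M ^ 2), ← map_smul]
  refine W.I_mono hp fun x => ?_
  simp only [map_pow, map_mul, map_smul, smul_eq_mul, mul_pow]
  exact mul_le_mul_of_nonneg_right (sq_le_sq' (abs_le.mp (h x)).1 (abs_le.mp (h x)).2)
    (sq_nonneg _)

/-- Young's inequality for the weighted integral. -/
lemma young {p : ℝ} (hp : -1 < p) (a : S) {δ : ℝ} (hδ : 0 < δ) :
    ∃ C ≥ 0, ∀ g h, |W.I p (a * g * h)| ≤ δ * W.I p (g ^ 2) + C * W.I p (h ^ 2) := by
  obtain ⟨M, hM, hb⟩ := W.exists_bound a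
  refine ⟨M ^ 2 / (4 * δ), by positivity, fun g h => ?_⟩
  have key : ∀ A G H : ℝ, |A| ≤ M → |A * G * H| ≤ δ * G ^ 2 + M ^ 2 / (4 * δ) * H ^ 2 := by
    intro A G H hA
    rw [abs_mul, abs_mul]
    have h1 : |A| * |G| * |H| ≤ M * |G| * |H| := by gcongr
    have h2 : δ * G ^ 2 + M ^ 2 / (4 * δ) * H ^ 2 - M * |G| * |H|
        = (2 * δ * |G| - M * |H|) ^ 2 / (4 * δ) := by
      rw [← sq_abs G, ← sq_abs H]; field_simp; ring
    have h3 : 0 ≤ (2 * δ * |G| - M * |H|) ^ 2 / (4 * δ) := by positivity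
    linarith
  rw [abs_le]
  have e : δ * W.I p (g ^ 2) + M ^ 2 / (4 * δ) * W.I p (h ^ 2)
      = W.I p (δ • g ^ 2 + (M ^ 2 / (4 * δ)) • h ^ 2) := by simp
  rw [e, ← map_neg]
  constructor <;> refine W.I_mono hp fun x => ?_
  · simpa [neg_add_rev, add_comm] using (abs_le.mp (key _ (W.ev x g) (W.ev x h) (hb x))).1
  · simpa using (abs_le.mp (key _ (W.ev x g) (W.ev x h) (hb x))).2

lemma young_sum {p : ℝ} (hp : -1 < p) (a : ι → ι → S) {δ : ℝ} (hδ : 0 < δ) :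
    ∃ C ≥ 0, ∀ g h : ι → S, |W.I p (∑ i, ∑ j, a i j * g i * h j)|
      ≤ δ * W.I p (∑ i, g i ^ 2) + C * W.I p (∑ i, h i ^ 2) := by
  have hn : (0 : ℝ) < δ / (Fintype.card ι + 1) := by positivity
  choose C hC h using fun i j => W.young hp (a i j) hn
  refine ⟨∑ i, ∑ j, C i j, Finset.sum_nonneg fun i _ => Finset.sum_nonneg fun j _ => hC i j,
    fun g k => ?_⟩
  have hk : ∀ j, W.I p (k j ^ 2) ≤ W.I p (∑ i, k i ^ 2) := fun j => by
    rw [map_sum]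
    exact Finset.single_le_sum (f := fun i => W.I p (k i ^ 2))
      (fun i _ => W.I_sq_nonneg hp _) (Finset.mem_univ j)
  have hg0 : 0 ≤ W.I p (∑ i, g i ^ 2) := by
    rw [map_sum]; exact Finset.sum_nonneg fun i _ => W.I_sq_nonneg hp _
  calc |W.I p (∑ i, ∑ j, a i j * g i * k j)|
      ≤ ∑ i, ∑ j, |W.I p (a i j * g i * k j)| := by
        rw [map_sum]
        refine (Finset.abs_sum_le_sum_abs _ _).trans (Finset.sum_le_sum fun i _ => ?_)
        rw [map_sum]
        exact Finset.abs_sum_le_sum_abs _ _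
    _ ≤ ∑ i, ∑ j, (δ / (Fintype.card ι + 1) * W.I p (g i ^ 2)
          + C i j * W.I p (∑ i, k i ^ 2)) := by
        refine Finset.sum_le_sum fun i _ => Finset.sum_le_sum fun j _ => ?_
        exact (h i j _ _).trans (add_le_add le_rfl (mul_le_mul_of_nonneg_left (hk j) (hC i j)))
    _ = (Fintype.card ι / (Fintype.card ι + 1)) * (δ * W.I p (∑ i, g i ^ 2))
          + (∑ i, ∑ j, C i j) * W.I p (∑ i, k i ^ 2) := by
        simp only [Finset.sum_add_distrib, Finset.sum_const, Finset.card_univ, nsmul_eq_mul,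
          ← Finset.sum_mul, ← Finset.mul_sum, map_sum]
        ring
    _ ≤ _ := by
        refine add_le_add (mul_le_of_le_one_left (mul_nonneg hδ.le hg0) ?_) le_rfl
        rw [div_le_one (by positivity)]; linarith

/-- Young's inequality, with the weight split evenly over the two factors. -/
lemma young_sum_split {p : ℝ} (hp : -1 < p) (a : ι → ι → S) {δ : ℝ} (hδ : 0 < δ) :
    ∃ C ≥ 0, ∀ g h : ι → S, |W.I (p + 1) (∑ i, ∑ j, a i j * g i * h j)|
      ≤ δ * W.I p (∑ i, g i ^ 2) + C * W.I (p + 2) (∑ i, h i ^ 2) := by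
  obtain ⟨C, hC, H⟩ := W.young_sum hp a hδ
  refine ⟨C, hC, fun g h => ?_⟩
  have := H g (fun i => W.r * h i)
  have e1 : ∑ i, (W.r * h i) ^ 2 = W.r ^ 2 * ∑ i, h i ^ 2 := by
    rw [Finset.mul_sum]; exact Finset.sum_congr rfl fun i _ => by ring
  have e2 : ∑ i, ∑ j, a i j * g i * (W.r * h j) = W.r * ∑ i, ∑ j, a i j * g i * h j := by
    simp only [Finset.mul_sum]
    exact Finset.sum_congr rfl fun i _ => Finset.sum_congr rfl fun j _ => by ring
  rwa [e1, e2, W.I_mul_r_sq hp, W.I_mul_r p hp] at this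

/-- The squared gradient. -/
def grad2 (g : S) : S := ∑ i, W.d i g ^ 2

lemma I_grad2_nonneg {p : ℝ} (hp : -1 < p) (g : S) : 0 ≤ W.I p (W.grad2 g) := by
  rw [grad2, map_sum]; exact Finset.sum_nonneg fun i _ => W.I_sq_nonneg hp _

/-- Shift of the weight away from the boundary. -/
lemma I_le_of_grad_r {p : ℝ} (hp : -1 < p) : ∃ C > 0, ∀ g : S, (∀ x, 0 ≤ W.ev x g) →
    W.I p g ≤ C * (W.I p (W.grad2 W.r * g) + W.I (p + 1) g) := by
  obtain ⟨c, hc, h⟩ := W.grad_r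
  refine ⟨c⁻¹, by positivity, fun g hg => ?_⟩
  rw [← W.I_mul_r p hp, ← map_add, ← smul_eq_mul, ← map_smul]
  refine W.I_mono hp fun x => ?_
  simp only [grad2, map_smul, map_add, map_mul, map_sum, map_pow, smul_eq_mul]
  rw [← add_mul, ← mul_assoc]
  refine le_mul_of_one_le_left (hg x) ?_
  rw [inv_mul_eq_div, one_le_div hc]
  linarith [h x]

/-- `∫ r^(p+1) g ≤ δ ∫ r^p g + C ∫ r^(p+2) g` for nonnegative `g`. -/
lemma I_interp {p : ℝ} (hp : -1 < p) {δ : ℝ} (hδ : 0 < δ) {g : S} (hg : ∀ x, 0 ≤ W.ev x g) :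
    W.I (p + 1) g ≤ δ * W.I p g + (4 * δ)⁻¹ * W.I (p + 2) g := by
  rw [← W.I_mul_r_sq hp, ← W.I_mul_r p hp]
  have e : δ * W.I p g + (4 * δ)⁻¹ * W.I p (W.r ^ 2 * g)
      = W.I p (δ • g + (4 * δ)⁻¹ • (W.r ^ 2 * g)) := by simp
  rw [e]
  refine W.I_mono hp fun x => ?_
  simp only [map_smul, map_add, map_mul, map_pow, smul_eq_mul]
  have : δ * W.ev x g + (4 * δ)⁻¹ * (W.ev x W.r ^ 2 * W.ev x g) - W.ev x W.r * W.ev x g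
      = (2 * δ - W.ev x W.r) ^ 2 / (4 * δ) * W.ev x g := by field_simp; ring
  have : 0 ≤ (2 * δ - W.ev x W.r) ^ 2 / (4 * δ) * W.ev x g := mul_nonneg (by positivity) (hg x)
  linarith

/-- Hardy's inequality. -/
lemma hardy {p : ℝ} (hp : -1 < p) : ∃ C ≥ 0, ∀ g : S,
    W.I p (g ^ 2) ≤ C * (W.I (p + 2) (g ^ 2) + W.I (p + 2) (W.grad2 g)) := by
  obtain ⟨A, hA, hA'⟩ := W.I_le_of_grad_r hp
  have hp1 : 0 < p + 1 := by linarith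
  obtain ⟨δ, hδ, hδA⟩ : ∃ δ > 0, A * ((p + 1)⁻¹ * (δ + δ) + δ) ≤ 1 / 2 := by
    refine ⟨(1 / 2) / (A * ((p + 1)⁻¹ * 2 + 1)), by positivity, le_of_eq ?_⟩
    field_simp; ring
  obtain ⟨C₁, hC₁, h₁⟩ := W.young hp (∑ i, W.d i (W.d i W.r)) hδ
  choose C₂ hC₂ h₂ using fun i => W.young hp (2 * W.d i W.r)
    (show 0 < δ / (Fintype.card ι + 1) by positivity)
  refine ⟨2 * A * ((p + 1)⁻¹ * (C₁ + ∑ i, C₂ i) + (4 * δ)⁻¹), by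
    have := Finset.sum_nonneg fun i (_ : i ∈ Finset.univ) => hC₂ i
    positivity, fun g => ?_⟩
  have ident : (p + 1) * W.I p (W.grad2 W.r * g ^ 2) =
      - (W.I p ((∑ i, W.d i (W.d i W.r)) * g * (W.r * g))
      + ∑ i, W.I p (2 * W.d i W.r * g * (W.r * W.d i g))) := by
    have : ∀ i, (p + 1) * W.I p (W.d i W.r ^ 2 * g ^ 2) =
        -(W.I p (W.d i (W.d i W.r) * g * (W.r * g))
      + W.I p (2 * W.d i W.r * g * (W.r * W.d i g))) := by
      intro i
      have := W.I_parts p hp i (W.d i W.r * g ^ 2)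
      rw [← mul_assoc, ← pow_two, ← W.I_mul_r p hp] at this
      rw [← map_add, ← neg_eq_iff_eq_neg, ← neg_mul, ← this]
      congr 1
      simp only [Derivation.leibniz, Derivation.leibniz_pow, smul_eq_mul, nsmul_eq_mul]
      push_cast; ring
    rw [grad2, Finset.sum_mul, map_sum, Finset.mul_sum, Finset.sum_congr rfl fun i _ => this i]
    rw [Finset.sum_neg_distrib, Finset.sum_add_distrib, Finset.sum_mul, Finset.sum_mul, map_sum]
  have hr2 : ∀ h : S, W.I p ((W.r * h) ^ 2) = W.I (p + 2) (h ^ 2) := fun h => by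
    rw [mul_pow, W.I_mul_r_sq hp]
  have g0 := W.I_sq_nonneg hp g
  have g2 := W.I_sq_nonneg (show -1 < p + 2 by linarith) g
  have gg := W.I_grad2_nonneg (show -1 < p + 2 by linarith) g
  have b1 := (abs_le.mp (h₁ g (W.r * g))).1
  rw [hr2] at b1
  have b2 : -(δ * W.I p (g ^ 2) + (∑ i, C₂ i) * W.I (p + 2) (W.grad2 g)) ≤
      ∑ i, W.I p (2 * W.d i W.r * g * (W.r * W.d i g)) := by
    have : ∀ i ∈ Finset.univ, -(δ / (Fintype.card ι + 1) * W.I p (g ^ 2)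
        + C₂ i * W.I (p + 2) (W.grad2 g))
        ≤ W.I p (2 * W.d i W.r * g * (W.r * W.d i g)) := fun i _ => by
      refine le_trans ?_ (abs_le.mp (h₂ i g (W.r * W.d i g))).1
      rw [hr2]
      gcongr
      · exact hC₂ i
      · rw [grad2, map_sum]
        exact Finset.single_le_sum (f := fun i => W.I (p + 2) (W.d i g ^ 2))
          (fun i _ => W.I_sq_nonneg (by linarith) _) (Finset.mem_univ i)
    refine le_trans ?_ (Finset.sum_le_sum this)
    rw [Finset.sum_neg_distrib, Finset.sum_add_distrib, Finset.sum_mul, Finset.sum_const,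
      Finset.card_univ, nsmul_eq_mul]
    have : (Fintype.card ι : ℝ) * (δ / (Fintype.card ι + 1) * W.I p (g ^ 2)) ≤
        δ * W.I p (g ^ 2) := by
      rw [← mul_assoc]
      refine mul_le_mul_of_nonneg_right ?_ g0
      rw [mul_div_assoc', div_le_iff₀ (by positivity)]
      nlinarith
    linarith
  have b3 := W.I_interp hp hδ (g := g ^ 2) (fun x => by simpa using sq_nonneg _)
  have b4 := hA' (g ^ 2) (fun x => by simpa using sq_nonneg _)
  have b5 : W.I p (W.grad2 W.r * g ^ 2) ≤ (p + 1)⁻¹ * ((δ + δ) * W.I p (g ^ 2)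
      + (C₁ + ∑ i, C₂ i) * (W.I (p + 2) (g ^ 2) + W.I (p + 2) (W.grad2 g))) := by
    rw [inv_mul_eq_div, le_div_iff₀ hp1, mul_comm, ident]
    have := Finset.sum_nonneg fun i (_ : i ∈ Finset.univ) => hC₂ i
    nlinarith [mul_nonneg hC₁ gg, mul_nonneg this g2]
  set Z := W.I (p + 2) (g ^ 2) + W.I (p + 2) (W.grad2 g)
  have b6 : W.I p (g ^ 2) ≤ A * ((p + 1)⁻¹ * (δ + δ) + δ) * W.I p (g ^ 2)
      + A * ((p + 1)⁻¹ * (C₁ + ∑ i, C₂ i) + (4 * δ)⁻¹) * Z := by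
    refine b4.trans ?_
    have : W.I (p + 2) (g ^ 2) ≤ Z := by simp only [Z]; linarith
    have h4 : (4 * δ)⁻¹ * W.I (p + 2) (g ^ 2) ≤ (4 * δ)⁻¹ * Z := by gcongr
    calc _ ≤ A * ((p + 1)⁻¹ * ((δ + δ) * W.I p (g ^ 2) + (C₁ + ∑ i, C₂ i) * Z)
        + (δ * W.I p (g ^ 2) + (4 * δ)⁻¹ * Z)) := by gcongr; linarith
      _ = _ := by ring
  nlinarith [mul_le_mul_of_nonneg_right hδA g0]

/-- The derivations as linear operators. -/
def D (i : ι) : Module.End ℝ S := (W.d i : S →ₗ[ℝ] S)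

/-- `G^{ij} ∂_j`. -/
def flux (i : ι) : Module.End ℝ S := ∑ j, W.G i j • W.D j

/-- `∂_i (G^{ij} ∂_j ·)`. -/
def divFlux : Module.End ℝ S := ∑ i, W.D i * W.flux i

/-- The conormal derivative `G^{ij} ∂_i r ∂_j`. -/
def N : Module.End ℝ S := ∑ i, W.d i W.r • W.flux i

/-- `r ∂_i (G^{ij} ∂_j ·) + γ G^{ij} ∂_i r ∂_j`. -/
def M (γ : ℝ) : Module.End ℝ S := W.r • W.divFlux + γ • W.N

lemma D_apply (i : ι) (g : S) : W.D i g = W.d i g := rfl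

lemma flux_apply (i : ι) (g : S) : W.flux i g = ∑ j, W.G i j * W.d j g := by
  simp [flux, D_apply]

lemma divFlux_apply (g : S) : W.divFlux g = ∑ i, W.d i (W.flux i g) := by
  simp [divFlux, D_apply]

lemma N_apply (g : S) : W.N g = ∑ i, W.d i W.r * W.flux i g := by
  simp [N]

lemma M_apply (γ : ℝ) (g : S) : W.M γ g = W.r * W.divFlux g + γ • W.N g := by
  simp [M]

lemma N_apply' (g : S) : W.N g = ∑ i, W.flux i W.r * W.d i g := by
  simp only [N_apply, flux_apply, Finset.mul_sum, Finset.sum_mul]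
  rw [Finset.sum_comm]
  refine Finset.sum_congr rfl fun i _ => Finset.sum_congr rfl fun j _ => ?_
  rw [W.G_symm j i]; ring

/-- The quadratic form `G^{ij} ∂_i g ∂_j g`. -/
def Q (g : S) : S := ∑ i, W.d i g * W.flux i g

lemma Q_apply (g : S) : W.Q g = ∑ i, ∑ j, W.G i j * W.d i g * W.d j g := by
  simp only [Q, flux_apply, Finset.mul_sum]
  exact Finset.sum_congr rfl fun i _ => Finset.sum_congr rfl fun j _ => by ring

lemma exists_grad2_le_Q : ∃ c > 0, ∀ g x, c * W.ev x (W.grad2 g) ≤ W.ev x (W.Q g) := by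
  obtain ⟨c, hc, h⟩ := W.G_elliptic
  refine ⟨c, hc, fun g x => ?_⟩
  simpa [Q_apply, grad2] using h x (fun i => W.ev x (W.d i g))

lemma grad2_nonneg (g : S) (x : X) : 0 ≤ W.ev x (W.grad2 g) := by
  simpa [grad2] using Finset.sum_nonneg fun i _ => sq_nonneg (W.ev x (W.d i g))

lemma I_grad2_le_Q : ∃ c > 0, ∀ p, -1 < p → ∀ g,
    c * W.I p (W.grad2 g) ≤ W.I p (W.Q g) := by
  obtain ⟨c, hc, h⟩ := W.exists_grad2_le_Q
  refine ⟨c, hc, fun p hp g => ?_⟩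
  rw [← smul_eq_mul, ← map_smul]
  exact W.I_mono hp fun x => by simpa using h g x

/-- The basic energy estimate for `1 - M α`. -/
lemma energy {α : ℝ} (hα : 0 < α) : ∃ C ≥ 0, ∀ f,
    W.I (α - 1) (f ^ 2) ≤ C * W.I (α - 1) ((f - W.M α f) ^ 2) ∧
    W.I α (W.grad2 f) ≤ C * W.I (α - 1) ((f - W.M α f) ^ 2) := by
  obtain ⟨c, hc, h⟩ := W.I_grad2_le_Q
  have hp : -1 < α - 1 := by linarith
  refine ⟨max 1 c⁻¹, by positivity, fun f => ?_⟩
  have key : W.I (α - 1) (f * (f - W.M α f)) = W.I (α - 1) (f ^ 2) + W.I α (W.Q f) := by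
    have h1 : ∀ i, W.I α (W.d i (f * W.flux i f)) =
        -α * W.I (α - 1) (W.d i W.r * (f * W.flux i f)) := by
      intro i
      have := W.I_parts (α - 1) hp i (f * W.flux i f)
      rwa [sub_add_cancel] at this
    have h2 := Finset.sum_congr (rfl : (Finset.univ : Finset ι) = _) fun i _ => h1 i
    rw [← map_sum, ← Finset.mul_sum, ← map_sum] at h2
    have h3 : ∑ i, W.d i (f * W.flux i f) = W.Q f + f * W.divFlux f := by
      simp only [Derivation.leibniz, smul_eq_mul, Finset.sum_add_distrib, Q, divFlux_apply,
        Finset.mul_sum]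
      rw [add_comm]; congr 1; exact Finset.sum_congr rfl fun i _ => by ring
    have h4 : ∑ i, W.d i W.r * (f * W.flux i f) = f * W.N f := by
      rw [N_apply, Finset.mul_sum]; exact Finset.sum_congr rfl fun i _ => by ring
    rw [h3, h4, map_add] at h2
    have h5 : W.I (α - 1) (W.r * (f * W.divFlux f)) = W.I α (f * W.divFlux f) := by
      rw [W.I_mul_r _ hp, sub_add_cancel]
    have h6 : f * (f - W.M α f) = f ^ 2 - W.r * (f * W.divFlux f) - α • (f * W.N f) := by
      rw [M_apply, Algebra.smul_def, Algebra.smul_def]; ring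
    rw [h6, map_sub, map_sub, map_smul, h5, smul_eq_mul]
    linarith
  have y : W.I (α - 1) (f * (f - W.M α f)) ≤
      (1 / 2) * W.I (α - 1) (f ^ 2) + (1 / 2) * W.I (α - 1) ((f - W.M α f) ^ 2) := by
    have e : (1 / 2) * W.I (α - 1) (f ^ 2) + (1 / 2) * W.I (α - 1) ((f - W.M α f) ^ 2)
        = W.I (α - 1) ((1 / 2 : ℝ) • f ^ 2 + (1 / 2 : ℝ) • (f - W.M α f) ^ 2) := by simp
    rw [e]
    refine W.I_mono hp fun x => ?_
    simp only [map_mul, map_add, map_smul, map_pow, smul_eq_mul]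
    nlinarith [sq_nonneg (W.ev x f - W.ev x (f - W.M α f))]
  have := h α (by linarith) f
  have n1 := W.I_sq_nonneg hp f
  have n2 := W.I_sq_nonneg hp (f - W.M α f)
  have n3 := W.I_grad2_nonneg (show -1 < α by linarith) f
  have n4 := mul_nonneg hc.le n3
  constructor
  · calc _ ≤ 1 * W.I (α - 1) ((f - W.M α f) ^ 2) := by linarith
      _ ≤ _ := by gcongr; exact le_max_left _ _
  · calc _ ≤ c⁻¹ * W.I (α - 1) ((f - W.M α f) ^ 2) := by
          rw [inv_mul_eq_div, le_div_iff₀ hc]; linarith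
      _ ≤ _ := by gcongr; exact le_max_right _ _

lemma d_N (i : ι) (g : S) : W.d i (W.N g) =
    (∑ l, W.d i (W.flux l W.r) * W.d l g) + ∑ l, W.flux l W.r * W.d i (W.d l g) := by
  rw [N_apply', map_sum, ← Finset.sum_add_distrib]
  refine Finset.sum_congr rfl fun l _ => ?_
  simp only [Derivation.leibniz, smul_eq_mul]; ring

lemma d_Q (l : ι) (g : S) : W.d l (W.Q g) =
    (∑ i, ∑ j, W.d l (W.G i j) * W.d i g * W.d j g)
      + 2 * ∑ i, W.flux i g * W.d i (W.d l g) := by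
  have : ∑ i, W.flux i g * W.d i (W.d l g) = ∑ i, ∑ j, W.G i j * W.d j g * W.d l (W.d i g) := by
    refine Finset.sum_congr rfl fun i _ => ?_
    rw [flux_apply, Finset.sum_mul, W.d_comm i l]
  have h' : ∑ i, ∑ j, W.G i j * W.d j g * W.d l (W.d i g)
      = ∑ i, ∑ j, W.G i j * W.d i g * W.d l (W.d j g) := by
    rw [Finset.sum_comm]
    exact Finset.sum_congr rfl fun i _ => Finset.sum_congr rfl fun j _ => by rw [W.G_symm j i]
  rw [two_mul]; nth_rewrite 2 [this]; rw [h', this, Q_apply]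
  simp only [map_sum, ← Finset.sum_add_distrib]
  refine Finset.sum_congr rfl fun i _ => Finset.sum_congr rfl fun j _ => ?_
  simp only [Derivation.leibniz, smul_eq_mul]; ring

/-- The coefficients of the lower order terms produced by the multiplier `N`. -/
lemma multiplier_identity : ∃ a : ι → ι → S, ∀ g,
    2 * (∑ i, W.flux i g * W.d i (W.N g)) - ∑ l, W.d l (W.flux l W.r * W.Q g)
      = ∑ i, ∑ j, a i j * W.d i g * W.d j g := by
  refine ⟨fun i j => (2 * ∑ k, W.G k i * W.d k (W.flux j W.r))
    - (∑ l, W.d l (W.flux l W.r)) * W.G i j - ∑ l, W.flux l W.r * W.d l (W.G i j), fun g => ?_⟩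
  have e1 : ∑ i, W.flux i g * W.d i (W.N g)
      = (∑ i, ∑ j, (∑ k, W.G k i * W.d k (W.flux j W.r)) * W.d i g * W.d j g)
        + ∑ i, ∑ l, W.flux i g * (W.flux l W.r * W.d i (W.d l g)) := by
    simp only [d_N, mul_add, Finset.sum_add_distrib, Finset.mul_sum]
    congr 1
    calc ∑ k, ∑ j, W.flux k g * (W.d k (W.flux j W.r) * W.d j g)
        = ∑ k, ∑ j, ∑ i, W.G k i * W.d k (W.flux j W.r) * W.d i g * W.d j g := by
          refine Finset.sum_congr rfl fun k _ => Finset.sum_congr rfl fun j _ => ?_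
          rw [flux_apply, Finset.sum_mul]
          exact Finset.sum_congr rfl fun i _ => by ring
      _ = ∑ i, ∑ j, ∑ k, W.G k i * W.d k (W.flux j W.r) * W.d i g * W.d j g := by
          rw [Finset.sum_comm]
          rw [Finset.sum_congr rfl fun j _ => Finset.sum_comm]
          rw [Finset.sum_comm]
      _ = _ := by simp only [Finset.sum_mul]
  have e2 : ∑ l, W.d l (W.flux l W.r * W.Q g)
      = (∑ i, ∑ j, (∑ l, W.d l (W.flux l W.r)) * W.G i j * W.d i g * W.d j g)
        + (∑ i, ∑ j, (∑ l, W.flux l W.r * W.d l (W.G i j)) * W.d i g * W.d j g)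
        + 2 * ∑ i, ∑ l, W.flux i g * (W.flux l W.r * W.d i (W.d l g)) := by
    have : ∀ l, W.d l (W.flux l W.r * W.Q g) = W.d l (W.flux l W.r) * W.Q g
      + W.flux l W.r * (∑ i, ∑ j, W.d l (W.G i j) * W.d i g * W.d j g)
      + 2 * ∑ i, W.flux i g * (W.flux l W.r * W.d i (W.d l g)) := by
      intro l
      rw [Derivation.leibniz, d_Q, smul_eq_mul, smul_eq_mul, mul_add, mul_left_comm _ 2,
        Finset.mul_sum (s := Finset.univ) (f := fun i => W.flux i g * _)]
      rw [Finset.sum_congr rfl fun i _ => mul_left_comm (W.flux i g) (W.flux l W.r) _]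
      ring
    simp only [this, Finset.sum_add_distrib, ← Finset.mul_sum]
    congr 1
    · congr 1
      · rw [← Finset.sum_mul, Q_apply, Finset.mul_sum]
        simp only [Finset.mul_sum]
        exact Finset.sum_congr rfl fun i _ => Finset.sum_congr rfl fun j _ => by ring
      · simp only [Finset.mul_sum, Finset.sum_mul]
        rw [Finset.sum_comm]
        refine Finset.sum_congr rfl fun i _ => ?_
        rw [Finset.sum_comm]
        exact Finset.sum_congr rfl fun j _ => Finset.sum_congr rfl fun l _ => by ring
    · rw [Finset.sum_comm]
      simp only [Finset.mul_sum]
  simp only [e1, e2, sub_mul, Finset.sum_sub_distrib, mul_assoc, ← Finset.mul_sum, mul_add]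
  ring

lemma exists_I_sum_sq_le (b : ι → S) : ∃ C ≥ 0, ∀ p, -1 < p → ∀ g,
    W.I p ((∑ i, b i * W.d i g) ^ 2) ≤ C * W.I p (W.grad2 g) := by
  choose M hM hM' using fun i => W.exists_bound (b i)
  refine ⟨∑ i, M i ^ 2, Finset.sum_nonneg fun i _ => sq_nonneg _, fun p hp g => ?_⟩
  rw [← smul_eq_mul, ← map_smul]
  refine W.I_mono hp fun x => ?_
  simp only [map_sum, map_pow, map_mul, map_smul, grad2, smul_eq_mul]
  refine (Finset.sum_mul_sq_le_sq_mul_sq _ _ _).trans ?_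
  refine mul_le_mul_of_nonneg_right (Finset.sum_le_sum fun i _ => ?_)
    (Finset.sum_nonneg fun i _ => sq_nonneg _)
  exact sq_le_sq' (abs_le.mp (hM' i x)).1 (abs_le.mp (hM' i x)).2

lemma exists_I_sq_N_le : ∃ C ≥ 0, ∀ p, -1 < p → ∀ g,
    W.I p (W.N g ^ 2) ≤ C * W.I p (W.grad2 g) := by
  simp only [N_apply']
  exact W.exists_I_sum_sq_le _

/-- The full gradient is controlled through the multiplier `N`. -/
lemma multiplier {p γ : ℝ} (hp : -1 < p) (hγ : p + 1 ≤ γ) : ∃ C ≥ 0, ∀ g,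
    W.I p (W.grad2 g) ≤ C * (W.I p (W.M γ g ^ 2) + W.I (p + 2) (W.grad2 g)) := by
  obtain ⟨A, hA, hA'⟩ := W.I_le_of_grad_r hp
  obtain ⟨c, hc, hQ⟩ := W.exists_grad2_le_Q
  obtain ⟨B, hB, hN⟩ := W.exists_I_sq_N_le
  obtain ⟨a, ha⟩ := W.multiplier_identity
  have hp1 : 0 < p + 1 := by linarith
  obtain ⟨K, hK⟩ : ∃ K, K = 2 / ((p + 1) * c ^ 2) := ⟨_, rfl⟩
  have hK0 : 0 < K := by rw [hK]; positivity
  obtain ⟨δ, hδ, hδA⟩ : ∃ δ > 0, A * (K * (δ * B + δ) + δ) ≤ 1 / 2 := by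
    refine ⟨(1 / 2) / (A * (K * (B + 1) + 1)), by positivity, le_of_eq ?_⟩
    field_simp
  obtain ⟨C₁, hC₁, h₁⟩ := W.young hp 1 hδ
  obtain ⟨C₂, hC₂, h₂⟩ := W.young_sum_split hp (fun i j => a i j) (show 0 < 2 * δ by positivity)
  refine ⟨2 * (A * (K * (C₁ + C₂) + (4 * δ)⁻¹)), by positivity, fun g => ?_⟩
  have i1 : W.I (p + 1) (∑ i, W.d i (W.flux i g * W.N g)) = -(p + 1) * W.I p (W.N g ^ 2) := by
    simp only [map_sum, W.I_parts p hp]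
    rw [← Finset.mul_sum, ← map_sum, pow_two]
    congr 2
    nth_rewrite 2 [N_apply]
    rw [Finset.sum_mul]; exact Finset.sum_congr rfl fun i _ => by ring
  have i2 : W.I (p + 1) (∑ i, W.d i (W.flux i W.r * W.Q g))
      = -(p + 1) * W.I p (W.Q W.r * W.Q g) := by
    simp only [map_sum, W.I_parts p hp]
    rw [← Finset.mul_sum, ← map_sum]
    congr 2
    nth_rewrite 2 [Q]
    rw [Finset.sum_mul]; exact Finset.sum_congr rfl fun i _ => by ring
  have i3 : ∑ i, W.d i (W.flux i g * W.N g)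
      = W.divFlux g * W.N g + ∑ i, W.flux i g * W.d i (W.N g) := by
    rw [divFlux_apply, Finset.sum_mul, ← Finset.sum_add_distrib]
    refine Finset.sum_congr rfl fun i _ => ?_
    rw [Derivation.leibniz, smul_eq_mul, smul_eq_mul]; ring
  have i4 : W.I p (W.M γ g * W.N g)
      = W.I (p + 1) (W.divFlux g * W.N g) + γ * W.I p (W.N g ^ 2) := by
    rw [M_apply, add_mul, map_add, mul_assoc, W.I_mul_r p hp, smul_mul_assoc, map_smul,
      smul_eq_mul, pow_two]
  have i5 : 2 * W.I (p + 1) (∑ i, W.flux i g * W.d i (W.N g))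
      - W.I (p + 1) (∑ i, W.d i (W.flux i W.r * W.Q g))
      = W.I (p + 1) (∑ i, ∑ j, a i j * W.d i g * W.d j g) := by
    rw [← ha g, map_sub, two_mul, two_mul, map_add]
  rw [i3, map_add] at i1
  have nN := W.I_sq_nonneg hp (W.N g)
  have g0 := W.I_grad2_nonneg hp g
  have g2 := W.I_grad2_nonneg (show -1 < p + 2 by linarith) g
  have m0 := W.I_sq_nonneg hp (W.M γ g)
  have b1 := (abs_le.mp (h₁ (W.N g) (W.M γ g))).2
  rw [one_mul, mul_comm (W.N g)] at b1
  have b2 := (abs_le.mp (h₂ (fun i => W.d i g) (fun i => W.d i g))).2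
  change _ ≤ 2 * δ * W.I p (W.grad2 g) + C₂ * W.I (p + 2) (W.grad2 g) at b2
  have b3 : (p + 1) / 2 * W.I p (W.Q W.r * W.Q g) ≤
      δ * B * W.I p (W.grad2 g) + C₁ * W.I p (W.M γ g ^ 2)
        + (δ * W.I p (W.grad2 g) + C₂ * W.I (p + 2) (W.grad2 g)) := by
    have := mul_le_mul_of_nonneg_left (hN p hp g) hδ.le
    have := mul_nonneg (sub_nonneg.mpr hγ) nN
    have := mul_nonneg hC₂ g2
    nlinarith
  have b4 : c ^ 2 * W.I p (W.grad2 W.r * W.grad2 g) ≤ W.I p (W.Q W.r * W.Q g) := by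
    rw [← smul_eq_mul, ← map_smul]
    refine W.I_mono hp fun x => ?_
    have h1 := mul_nonneg hc.le (W.grad2_nonneg g x)
    have h2 := mul_nonneg hc.le (W.grad2_nonneg W.r x)
    have := mul_le_mul (hQ W.r x) (hQ g x) h1 (h2.trans (hQ W.r x))
    simp only [map_smul, map_mul, smul_eq_mul]
    linarith
  set Z := W.I p (W.M γ g ^ 2) + W.I (p + 2) (W.grad2 g)
  have b5 : W.I p (W.grad2 W.r * W.grad2 g) ≤
      K * ((δ * B + δ) * W.I p (W.grad2 g) + (C₁ + C₂) * Z) := by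
    rw [hK, div_mul_eq_mul_div, le_div_iff₀ (by positivity)]
    have h1 : (p + 1) * (c ^ 2 * W.I p (W.grad2 W.r * W.grad2 g))
      ≤ (p + 1) * W.I p (W.Q W.r * W.Q g) := by gcongr
    have h2 : C₁ * W.I p (W.M γ g ^ 2) ≤ C₁ * Z := by gcongr; simp only [Z]; linarith
    have h3 : C₂ * W.I (p + 2) (W.grad2 g) ≤ C₂ * Z := by gcongr; simp only [Z]; linarith
    nlinarith
  have b6 := hA' _ (W.grad2_nonneg g)
  have b7 := W.I_interp hp hδ (W.grad2_nonneg g)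
  have b8 : W.I p (W.grad2 g) ≤ A * (K * (δ * B + δ) + δ) * W.I p (W.grad2 g)
      + A * (K * (C₁ + C₂) + (4 * δ)⁻¹) * Z := by
    refine b6.trans ?_
    have h4 : (4 * δ)⁻¹ * W.I (p + 2) (W.grad2 g) ≤ (4 * δ)⁻¹ * Z := by
      gcongr; simp only [Z]; linarith
    calc _ ≤ A * (K * ((δ * B + δ) * W.I p (W.grad2 g) + (C₁ + C₂) * Z)
        + (δ * W.I p (W.grad2 g) + (4 * δ)⁻¹ * Z)) := by gcongr; linarith
      _ = _ := by ring
  nlinarith [mul_le_mul_of_nonneg_right hδA g0]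

lemma I_single_le_grad2 {p : ℝ} (hp : -1 < p) (i : ι) (g : S) :
    W.I p (W.d i g ^ 2) ≤ W.I p (W.grad2 g) := by
  rw [grad2, map_sum]
  exact Finset.single_le_sum (f := fun i => W.I p (W.d i g ^ 2))
    (fun i _ => W.I_sq_nonneg hp _) (Finset.mem_univ i)

lemma exists_I_succ_le : ∃ C ≥ 0, ∀ p, -1 < p → ∀ g, (∀ x, 0 ≤ W.ev x g) →
    W.I (p + 1) g ≤ C * W.I p g := by
  obtain ⟨C, hC, h⟩ := W.exists_bound W.r
  refine ⟨C, hC.le, fun p hp g hg => ?_⟩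
  rw [← W.I_mul_r p hp, ← smul_eq_mul C, ← map_smul]
  refine W.I_mono hp fun x => ?_
  simp only [map_mul, map_smul, smul_eq_mul]
  exact mul_le_mul_of_nonneg_right (abs_le.mp (h x)).2 (hg x)

/-- Second derivatives are controlled, with a gain of one power of `r`. -/
lemma interior {p : ℝ} (hp : -1 < p) (k : ι) : ∃ C ≥ 0, ∀ g,
    W.I (p + 2) (W.grad2 (W.d k g))
      ≤ C * (W.I p ((W.r * W.divFlux g) ^ 2) + W.I p (W.grad2 g)) := by
  obtain ⟨c, hc, hQ⟩ := W.I_grad2_le_Q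
  have hp1 : -1 < p + 1 := by linarith
  have hp2 : -1 < p + 2 := by linarith
  have hpp : 0 < p + 2 := by linarith
  obtain ⟨δ, hδ, hδA⟩ : ∃ δ > 0, δ * (2 + (p + 2)) ≤ c / 2 :=
    ⟨(c / 2) / (2 + (p + 2)), by positivity, le_of_eq (by field_simp)⟩
  obtain ⟨B, hB, hN⟩ := W.exists_I_sq_N_le
  obtain ⟨R, hR, hR'⟩ := W.exists_I_succ_le
  obtain ⟨B', hB', hE⟩ := W.exists_I_sum_sq_le (fun j => ∑ i, W.d i W.r * W.d k (W.G i j))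
  obtain ⟨C₁, hC₁, h₁⟩ := W.young hp 1 hδ
  obtain ⟨C₂, hC₂, h₂⟩ := W.young hp (W.d k W.r) one_pos
  obtain ⟨C₃, hC₃, h₃⟩ := W.young hp 1 (show 0 < δ / (B + 1) by positivity)
  obtain ⟨C₄, hC₄, h₄⟩ := W.young hp1 1 one_pos
  obtain ⟨C₅, hC₅, h₅⟩ := W.young_sum hp2 (fun i j => W.d k (W.G i j)) hδ
  have hr2 : ∀ h : S, W.I p ((W.r * h) ^ 2) = W.I (p + 2) (h ^ 2) := fun h => by
    rw [mul_pow, W.I_mul_r_sq hp]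
  refine ⟨2 / c * (C₁ + (p + 2) * (1 + C₂) + (p + 2) * C₃ + (p + 2) * (R + C₄ * (B' * R))
    + C₅ * (R * R)), by positivity, fun g => ?_⟩
  have dflux : ∀ i, W.d k (W.flux i g)
      = W.flux i (W.d k g) + ∑ j, W.d k (W.G i j) * W.d j g := by
    intro i
    simp only [flux_apply, map_sum, ← Finset.sum_add_distrib]
    refine Finset.sum_congr rfl fun j _ => ?_
    rw [Derivation.leibniz, smul_eq_mul, smul_eq_mul, W.d_comm k j]; ring
  obtain ⟨h, hh⟩ : ∃ h, h = W.d k g := ⟨_, rfl⟩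
  obtain ⟨v, hv⟩ : ∃ v, v = W.divFlux g := ⟨_, rfl⟩
  obtain ⟨E, hEdef⟩ : ∃ E, E = ∑ j, (∑ i, W.d i W.r * W.d k (W.G i j)) * W.d j g := ⟨_, rfl⟩
  have a1 : ∑ i, W.d i h * W.d k (W.flux i g)
      = W.Q h + ∑ i, ∑ j, W.d k (W.G i j) * W.d i h * W.d j g := by
    simp only [dflux, mul_add, Finset.sum_add_distrib, Q, hh, Finset.mul_sum]
    congr 1
    exact Finset.sum_congr rfl fun i _ => Finset.sum_congr rfl fun j _ => by ring
  have a2 : ∑ i, W.d i W.r * (h * W.d k (W.flux i g)) = h * W.N h + h * E := by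
    rw [hEdef]
    simp only [dflux, N_apply, mul_add, Finset.sum_add_distrib, Finset.mul_sum, Finset.sum_mul,
      ← hh]
    congr 1
    · exact Finset.sum_congr rfl fun i _ => by ring
    · rw [Finset.sum_comm]
      exact Finset.sum_congr rfl fun i _ => Finset.sum_congr rfl fun j _ => by ring
  have a3 : ∑ i, W.d i (h * W.d k (W.flux i g))
      = ∑ i, W.d i h * W.d k (W.flux i g) + h * W.d k v := by
    rw [hv, divFlux_apply, map_sum, Finset.mul_sum, ← Finset.sum_add_distrib]
    refine Finset.sum_congr rfl fun i _ => ?_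
    rw [Derivation.leibniz, smul_eq_mul, smul_eq_mul, W.d_comm k i]; ring
  have e2 : p + 1 + 1 = p + 2 := by ring
  have b1 : W.I (p + 2) (∑ i, W.d i (h * W.d k (W.flux i g)))
      = -(p + 2) * W.I (p + 1) (h * W.N h + h * E) := by
    rw [← a2, ← e2]
    simp only [map_sum, W.I_parts (p + 1) hp1]
    rw [Finset.mul_sum]
  have b2 : W.I (p + 2) (W.d k (h * v)) = -(p + 2) * W.I (p + 1) (W.d k W.r * (h * v)) := by
    have := W.I_parts (p + 1) hp1 k (h * v)
    rwa [e2] at this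
  rw [a3, a1, map_add, map_add, map_add] at b1
  rw [Derivation.leibniz, smul_eq_mul, smul_eq_mul, map_add] at b2
  have t1 := (abs_le.mp (h₁ (W.r * W.d k h) (W.r * v))).2
  rw [one_mul, show W.r * W.d k h * (W.r * v) = W.r ^ 2 * (v * W.d k h) by ring,
    W.I_mul_r_sq hp, hr2] at t1
  have t2 := (abs_le.mp (h₂ h (W.r * v))).2
  rw [show W.d k W.r * h * (W.r * v) = W.r * (W.d k W.r * (h * v)) by ring, W.I_mul_r p hp] at t2
  have t3 := (abs_le.mp (h₃ (W.r * W.N h) h)).1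
  rw [hr2, one_mul, show W.r * W.N h * h = W.r * (h * W.N h) by ring, W.I_mul_r p hp] at t3
  have t4 := (abs_le.mp (h₄ h E)).1
  simp only [one_mul] at t4
  have t5 := (abs_le.mp (h₅ (fun i => W.d i h) (fun i => W.d i g))).1
  change -(δ * W.I (p + 2) (W.grad2 h) + C₅ * W.I (p + 2) (W.grad2 g)) ≤ _ at t5
  have hsq : ∀ z : S, ∀ x, 0 ≤ W.ev x (z ^ 2) := fun z x => by simpa using sq_nonneg _
  have hg0 : 0 ≤ W.I p (W.grad2 g) := W.I_grad2_nonneg hp g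
  have hh0 : 0 ≤ W.I (p + 2) (W.grad2 h) := W.I_grad2_nonneg hp2 h
  have hv0 : 0 ≤ W.I p ((W.r * v) ^ 2) := W.I_sq_nonneg hp _
  have u1 : W.I (p + 2) (W.d k h ^ 2) ≤ W.I (p + 2) (W.grad2 h) := W.I_single_le_grad2 hp2 k h
  have u2 : W.I p (h ^ 2) ≤ W.I p (W.grad2 g) := hh ▸ W.I_single_le_grad2 hp k g
  have u3 : δ / (B + 1) * W.I (p + 2) (W.N h ^ 2) ≤ δ * W.I (p + 2) (W.grad2 h) := by
    calc _ ≤ δ / (B + 1) * (B * W.I (p + 2) (W.grad2 h)) := by gcongr; exact hN _ hp2 h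
      _ = (B / (B + 1)) * (δ * W.I (p + 2) (W.grad2 h)) := by field_simp
      _ ≤ _ := by
        refine mul_le_of_le_one_left (by positivity) ?_
        rw [div_le_one (by positivity)]; linarith
  have u4 : W.I (p + 1) (h ^ 2) ≤ R * W.I p (W.grad2 g) :=
    (hR' p hp _ (hsq h)).trans (by gcongr)
  have u5 : W.I (p + 1) (E ^ 2) ≤ B' * R * W.I p (W.grad2 g) := by
    rw [hEdef, mul_assoc]
    exact (hE (p + 1) hp1 g).trans (by gcongr; exact hR' p hp _ (W.grad2_nonneg g))
  have u6 : W.I (p + 2) (W.grad2 g) ≤ R * R * W.I p (W.grad2 g) := by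
    rw [← e2, mul_assoc]
    exact (hR' (p + 1) hp1 _ (W.grad2_nonneg g)).trans
      (by gcongr; exact hR' p hp _ (W.grad2_nonneg g))
  have u7 := hQ (p + 2) hp2 h
  rw [← hh, ← hv]
  set V := W.I p ((W.r * v) ^ 2)
  set Γ := W.I p (W.grad2 g)
  set H := W.I (p + 2) (W.grad2 h)
  have w1 : W.I (p + 2) (v * W.d k h) ≤ δ * H + C₁ * V := t1.trans (by gcongr)
  have w2 : W.I (p + 1) (W.d k W.r * (h * v)) ≤ Γ + C₂ * V := t2.trans (by rw [one_mul]; gcongr)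
  have w3 : -(δ * H + C₃ * Γ) ≤ W.I (p + 1) (h * W.N h) := le_trans (by gcongr) t3
  have w4 : -(R * Γ + C₄ * (B' * R * Γ)) ≤ W.I (p + 1) (h * E) :=
    le_trans (by gcongr) t4
  have w5 : -(δ * H + C₅ * (R * R * Γ)) ≤
      W.I (p + 2) (∑ i, ∑ j, W.d k (W.G i j) * W.d i h * W.d j g) := le_trans (by gcongr) t5
  have s2 := mul_le_mul_of_nonneg_left w2 hpp.le
  have s3 := mul_le_mul_of_nonneg_left w3 hpp.le
  have s4 := mul_le_mul_of_nonneg_left w4 hpp.le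
  have fin : c * H ≤ δ * (2 + (p + 2)) * H + (C₁ + (p + 2) * C₂) * V
      + ((p + 2) + (p + 2) * C₃ + (p + 2) * (R + C₄ * (B' * R)) + C₅ * (R * R)) * Γ := by
    nlinarith
  have fin2 := mul_le_mul_of_nonneg_right hδA hh0
  have fin3 : (C₁ + (p + 2) * C₂) * V
      + ((p + 2) + (p + 2) * C₃ + (p + 2) * (R + C₄ * (B' * R)) + C₅ * (R * R)) * Γ
      ≤ (C₁ + (p + 2) * (1 + C₂) + (p + 2) * C₃ + (p + 2) * (R + C₄ * (B' * R))
    + C₅ * (R * R)) * (V + Γ) := by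
    have : 0 ≤ ((p + 2) + (p + 2) * C₃ + (p + 2) * (R + C₄ * (B' * R))
      + C₅ * (R * R)) * V + (C₁ + (p + 2) * C₂) * Γ := by positivity
    linarith
  rw [div_mul_eq_mul_div, div_mul_eq_mul_div, le_div_iff₀ hc]
  linarith

/-- Iterated derivatives. -/
def word (w : List ι) : Module.End ℝ S := (w.map W.D).prod

lemma word_nil : W.word [] = 1 := rfl

lemma word_cons (i : ι) (w : List ι) : W.word (i :: w) = W.D i * W.word w := by
  simp [word]

lemma D_comm (i j : ι) : W.D i * W.D j = W.D j * W.D i :=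
  LinearMap.ext fun f => W.d_comm i j f

lemma D_word_comm (i : ι) (w : List ι) : W.D i * W.word w = W.word w * W.D i := by
  induction w with
  | nil => simp [word_nil]
  | cons j w ih => rw [word_cons, ← mul_assoc, D_comm, mul_assoc, ih, mul_assoc]

lemma word_comm (v w : List ι) : W.word v * W.word w = W.word w * W.word v := by
  induction v with
  | nil => simp [word_nil]
  | cons j v ih => rw [word_cons, mul_assoc, ih, ← mul_assoc, D_word_comm, mul_assoc]

lemma D_mul_smul (i : ι) (a : S) (P : Module.End ℝ S) :
    W.D i * (a • P) = W.d i a • P + a • (W.D i * P) := by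
  ext f
  simp only [Module.End.mul_apply, LinearMap.add_apply, LinearMap.smul_apply, D_apply,
    Derivation.leibniz, smul_eq_mul]
  ring

/-- Differential operators of order at most `n`. -/
def Ord (n : ℤ) : Submodule S (Module.End ℝ S) :=
  Submodule.span S {P | ∃ w : List ι, (w.length : ℤ) ≤ n ∧ W.word w = P}

lemma word_mem_Ord {w : List ι} {n : ℤ} (h : (w.length : ℤ) ≤ n) : W.word w ∈ W.Ord n :=
  Submodule.subset_span ⟨w, h, rfl⟩

lemma one_mem_Ord : (1 : Module.End ℝ S) ∈ W.Ord 0 := W.word_mem_Ord (w := []) (by simp)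

lemma D_mem_Ord (i : ι) : W.D i ∈ W.Ord 1 := by
  simpa [word] using W.word_mem_Ord (w := [i]) (n := 1) (by simp)

lemma Ord_mono {m n : ℤ} (h : m ≤ n) : W.Ord m ≤ W.Ord n :=
  Submodule.span_mono fun _ ⟨w, hw, e⟩ => ⟨w, hw.trans h, e⟩

lemma Ord_le {n : ℤ} {N : Submodule S (Module.End ℝ S)}
    (h : ∀ w : List ι, (w.length : ℤ) ≤ n → W.word w ∈ N) : W.Ord n ≤ N :=
  Submodule.span_le.mpr fun _ ⟨w, hw, e⟩ => e ▸ h w hw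

lemma D_mul_mem_Ord (i : ι) {n : ℤ} {P : Module.End ℝ S} (hP : P ∈ W.Ord n) :
    W.D i * P ∈ W.Ord (n + 1) := by
  induction hP using Submodule.span_induction with
  | mem P h =>
    obtain ⟨w, hw, rfl⟩ := h
    rw [← word_cons]
    exact W.word_mem_Ord (by push_cast [List.length_cons]; omega)
  | zero => simp
  | add P Q hP hQ h₁ h₂ => rw [mul_add]; exact add_mem h₁ h₂
  | smul a P hP h =>
    rw [D_mul_smul]
    exact add_mem (Submodule.smul_mem _ _ (W.Ord_mono (by omega) hP)) (Submodule.smul_mem _ _ h)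

lemma word_mul_mem_Ord (v : List ι) {n : ℤ} {P : Module.End ℝ S} (hP : P ∈ W.Ord n) :
    W.word v * P ∈ W.Ord (v.length + n) := by
  induction v with
  | nil => simpa [word_nil] using hP
  | cons i v ih =>
    rw [word_cons, mul_assoc]
    exact W.Ord_mono (by push_cast [List.length_cons]; omega) (W.D_mul_mem_Ord i ih)

lemma mul_mem_Ord {m n : ℤ} {P Q : Module.End ℝ S} (hP : P ∈ W.Ord m) (hQ : Q ∈ W.Ord n) :
    P * Q ∈ W.Ord (m + n) := by
  induction hP using Submodule.span_induction with
  | mem P h =>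
    obtain ⟨w, hw, rfl⟩ := h
    exact W.Ord_mono (by omega) (W.word_mul_mem_Ord w hQ)
  | zero => simp
  | add P R hP hR h₁ h₂ => rw [add_mul]; exact add_mem h₁ h₂
  | smul a P hP h => rw [smul_mul_assoc]; exact Submodule.smul_mem _ _ h

/-- Moving a coefficient through an operator lowers the order. -/
lemma mul_smul_sub_mem_Ord {m n : ℤ} {P Q : Module.End ℝ S} (a : S) (hP : P ∈ W.Ord m)
    (hQ : Q ∈ W.Ord n) : P * (a • Q) - a • (P * Q) ∈ W.Ord (m + n - 1) := by
  induction hP using Submodule.span_induction with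
  | mem P h =>
    obtain ⟨w, hw, rfl⟩ := h
    refine W.Ord_mono (show (w.length : ℤ) + n - 1 ≤ m + n - 1 by omega) ?_
    clear hw
    induction w with
    | nil => simp [word_nil]
    | cons i w ih =>
      have : W.word (i :: w) * (a • Q) - a • (W.word (i :: w) * Q)
          = W.D i * (W.word w * (a • Q) - a • (W.word w * Q)) + W.d i a • (W.word w * Q) := by
        rw [word_cons, mul_sub, D_mul_smul, mul_assoc, mul_assoc]; abel
      rw [this]
      refine add_mem (W.Ord_mono ?_ (W.D_mul_mem_Ord i ih))
        (Submodule.smul_mem _ _ (W.Ord_mono ?_ (W.word_mul_mem_Ord w hQ))) <;>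
      · push_cast [List.length_cons]; omega
  | zero => simp
  | add P R hP hR h₁ h₂ =>
    rw [add_mul, add_mul, smul_add, add_sub_add_comm]; exact add_mem h₁ h₂
  | smul b P hP h =>
    rw [smul_mul_assoc, smul_mul_assoc, smul_comm a b, ← smul_sub]
    exact Submodule.smul_mem _ _ h

/-- Commutators lower the order. -/
lemma commutator_mem_Ord {m n : ℤ} {P Q : Module.End ℝ S} (hP : P ∈ W.Ord m)
    (hQ : Q ∈ W.Ord n) : P * Q - Q * P ∈ W.Ord (m + n - 1) := by
  induction hP using Submodule.span_induction with
  | mem P h =>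
    obtain ⟨v, hv, rfl⟩ := h
    induction hQ using Submodule.span_induction with
    | mem Q h =>
      obtain ⟨w, hw, rfl⟩ := h
      rw [word_comm, sub_self]; exact zero_mem _
    | zero => simp
    | add P R hP hR h₁ h₂ =>
      rw [add_mul, mul_add, add_sub_add_comm]; exact add_mem h₁ h₂
    | smul b Q hQ h =>
      have : W.word v * (b • Q) - b • Q * W.word v
          = (W.word v * (b • Q) - b • (W.word v * Q)) + b • (W.word v * Q - Q * W.word v) := by
        rw [smul_mul_assoc, smul_sub]; abel
      rw [this]
      exact add_mem (W.mul_smul_sub_mem_Ord b (W.word_mem_Ord hv) hQ) (Submodule.smul_mem _ _ h)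
  | zero => simp
  | add P R hP hR h₁ h₂ =>
    rw [add_mul, mul_add, add_sub_add_comm]; exact add_mem h₁ h₂
  | smul b P hP h =>
    have : b • P * Q - Q * (b • P) = b • (P * Q - Q * P) - (Q * (b • P) - b • (Q * P)) := by
      rw [smul_mul_assoc, smul_sub]; abel
    rw [this]
    exact sub_mem (Submodule.smul_mem _ _ h)
      (W.Ord_mono (by omega) (W.mul_smul_sub_mem_Ord b hQ hP))

/-- Operators of the form `A + r B` with `A` of order `k` and `B` of order `k + 1`. -/
def Low (k : ℤ) : Submodule S (Module.End ℝ S) :=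
  W.Ord k ⊔ (W.Ord (k + 1)).map (LinearMap.lsmul S (Module.End ℝ S) W.r)

lemma mem_Low {k : ℤ} {P : Module.End ℝ S} :
    P ∈ W.Low k ↔ ∃ A ∈ W.Ord k, ∃ B ∈ W.Ord (k + 1), P = A + W.r • B := by
  simp [Low, Submodule.mem_sup, eq_comm]

lemma Ord_le_Low (k : ℤ) : W.Ord k ≤ W.Low k := le_sup_left

lemma smul_mem_Low {k : ℤ} {P : Module.End ℝ S} (hP : P ∈ W.Ord (k + 1)) : W.r • P ∈ W.Low k :=
  W.mem_Low.mpr ⟨0, zero_mem _, P, hP, by simp⟩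

lemma Low_le_Ord (k : ℤ) : W.Low k ≤ W.Ord (k + 1) := fun P hP => by
  obtain ⟨A, hA, B, hB, rfl⟩ := W.mem_Low.mp hP
  exact add_mem (W.Ord_mono (by omega) hA) (Submodule.smul_mem _ _ hB)

lemma Low_mono {m n : ℤ} (h : m ≤ n) : W.Low m ≤ W.Low n :=
  sup_le_sup (W.Ord_mono h) (Submodule.map_mono (W.Ord_mono (by omega)))

lemma Low_mul_mem {k m : ℤ} {P Q : Module.End ℝ S} (hP : P ∈ W.Low k) (hQ : Q ∈ W.Ord m) :
    P * Q ∈ W.Low (k + m) := by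
  obtain ⟨A, hA, B, hB, rfl⟩ := W.mem_Low.mp hP
  rw [add_mul, smul_mul_assoc]
  exact add_mem (W.Ord_le_Low _ (W.mul_mem_Ord hA hQ))
    (W.smul_mem_Low (W.Ord_mono (by omega) (W.mul_mem_Ord hB hQ)))

lemma mul_mem_Low {k m : ℤ} {P Q : Module.End ℝ S} (hP : P ∈ W.Ord m) (hQ : Q ∈ W.Low k) :
    P * Q ∈ W.Low (k + m) := by
  obtain ⟨A, hA, B, hB, rfl⟩ := W.mem_Low.mp hQ
  have : P * (A + W.r • B) = P * A + ((P * (W.r • B) - W.r • (P * B)) + W.r • (P * B)) := by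
    rw [mul_add]; abel
  rw [this]
  exact add_mem (W.Ord_le_Low _ (W.Ord_mono (by omega) (W.mul_mem_Ord hP hA)))
    (add_mem (W.Ord_le_Low _ (W.Ord_mono (by omega) (W.mul_smul_sub_mem_Ord _ hP hB)))
      (W.smul_mem_Low (W.Ord_mono (by omega) (W.mul_mem_Ord hP hB))))

lemma flux_mem_Ord (i : ι) : W.flux i ∈ W.Ord 1 :=
  sum_mem fun j _ => Submodule.smul_mem _ _ (W.D_mem_Ord j)

lemma divFlux_mem_Ord : W.divFlux ∈ W.Ord 2 :=
  sum_mem fun i _ => W.Ord_mono (by norm_num) (W.mul_mem_Ord (W.D_mem_Ord i) (W.flux_mem_Ord i))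

lemma N_mem_Ord : W.N ∈ W.Ord 1 :=
  sum_mem fun i _ => Submodule.smul_mem _ _ (W.flux_mem_Ord i)

lemma real_smul_mem {N : Submodule S (Module.End ℝ S)} (c : ℝ) {P : Module.End ℝ S}
    (hP : P ∈ N) : c • P ∈ N := by
  rw [← algebraMap_smul S c P]; exact N.smul_mem _ hP

/-- Vector fields tangent to the level sets of `r`. -/
def T (t : ι × ι) : Module.End ℝ S := W.d t.1 W.r • W.D t.2 - W.d t.2 W.r • W.D t.1

lemma T_mem_Ord (t : ι × ι) : W.T t ∈ W.Ord 1 :=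
  sub_mem (Submodule.smul_mem _ _ (W.D_mem_Ord _)) (Submodule.smul_mem _ _ (W.D_mem_Ord _))

lemma T_mul_r_smul (t : ι × ι) (P : Module.End ℝ S) : W.T t * (W.r • P) = W.r • (W.T t * P) := by
  rw [T, sub_mul, sub_mul, smul_mul_assoc, smul_mul_assoc, D_mul_smul, D_mul_smul, smul_mul_assoc,
    smul_mul_assoc]
  simp only [smul_add, smul_sub, smul_smul, mul_comm]
  abel

lemma commutator_M_T_mem_Low (γ : ℝ) (t : ι × ι) : W.M γ * W.T t - W.T t * W.M γ ∈ W.Low 1 := by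
  have : W.M γ * W.T t - W.T t * W.M γ = W.r • (W.divFlux * W.T t - W.T t * W.divFlux)
      + γ • (W.N * W.T t - W.T t * W.N) := by
    rw [M, add_mul, mul_add, T_mul_r_smul, smul_mul_assoc, smul_mul_assoc, mul_smul_comm,
      smul_sub, smul_sub]
    abel
  rw [this]
  exact add_mem
    (W.smul_mem_Low (W.Ord_mono (by norm_num)
      (W.commutator_mem_Ord W.divFlux_mem_Ord (W.T_mem_Ord t))))
    (W.Ord_le_Low _ (real_smul_mem γ (W.Ord_mono (by norm_num)
      (W.commutator_mem_Ord W.N_mem_Ord (W.T_mem_Ord t)))))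

/-- Iterated tangential derivatives. -/
def tang (t : List (ι × ι)) : Module.End ℝ S := (t.map W.T).prod

lemma tang_nil : W.tang [] = 1 := rfl

lemma tang_cons (a : ι × ι) (t : List (ι × ι)) : W.tang (a :: t) = W.T a * W.tang t := by
  simp [tang]

lemma tang_mem_Ord (t : List (ι × ι)) : W.tang t ∈ W.Ord t.length := by
  induction t with
  | nil => exact W.one_mem_Ord
  | cons a t ih =>
    rw [tang_cons]
    exact W.Ord_mono (by push_cast [List.length_cons]; omega) (W.mul_mem_Ord (W.T_mem_Ord a) ih)

lemma tang_mul_word_mem_Ord (t : List (ι × ι)) (w : List ι) :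
    W.tang t * W.word w ∈ W.Ord (t.length + w.length) :=
  W.mul_mem_Ord (W.tang_mem_Ord t) (W.word_mem_Ord le_rfl)

/-- The error terms in the commutation of `M` with `q` tangential and `p` arbitrary
derivatives. -/
def Err (q p : ℕ) : Submodule S (Module.End ℝ S) :=
  W.Low (q + p) ⊔ Submodule.span S {P | ∃ (i : ι) (t : List (ι × ι)) (w : List ι),
    t.length = q + 1 ∧ w.length + 1 = p ∧ W.D i * (W.tang t * W.word w) = P}

lemma Low_le_Err (q p : ℕ) : W.Low (q + p) ≤ W.Err q p := le_sup_left

lemma Err_le {q p : ℕ} {N : Submodule S (Module.End ℝ S)} (h₁ : W.Low (q + p) ≤ N)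
    (h₂ : ∀ (i : ι) (t : List (ι × ι)) (w : List ι), t.length = q + 1 → w.length + 1 = p →
      W.D i * (W.tang t * W.word w) ∈ N) : W.Err q p ≤ N :=
  sup_le h₁ (Submodule.span_le.mpr fun _ ⟨i, t, w, ht, hw, e⟩ => e ▸ h₂ i t w ht hw)

lemma mem_Err (i : ι) {t : List (ι × ι)} {w : List ι} {q p : ℕ} (ht : t.length = q + 1)
    (hw : w.length + 1 = p) : W.D i * (W.tang t * W.word w) ∈ W.Err q p :=
  Submodule.mem_sup_right (Submodule.subset_span ⟨i, t, w, ht, hw, rfl⟩)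

lemma Err_le_Ord (q p : ℕ) : W.Err q p ≤ W.Ord (q + p + 1) := by
  refine W.Err_le (W.Low_le_Ord _) fun i t w ht hw => ?_
  exact W.Ord_mono (by omega) (W.D_mul_mem_Ord i (W.tang_mul_word_mem_Ord t w))

/-- Left multiplication by a first order operator maps errors to errors as soon as it does so
for the generators. -/
lemma mul_mem_Err_of_generators {q p q' p' : ℕ} {Y : Module.End ℝ S} (hY : Y ∈ W.Ord 1)
    (hqp : q' + p' = q + p + 1)
    (h : ∀ (i : ι) (t : List (ι × ι)) (w : List ι), t.length = q + 1 → w.length + 1 = p →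
      Y * (W.D i * (W.tang t * W.word w)) ∈ W.Err q' p')
    {P : Module.End ℝ S} (hP : P ∈ W.Err q p) : Y * P ∈ W.Err q' p' := by
  obtain ⟨A, hA, B, hB, rfl⟩ := Submodule.mem_sup.mp hP
  rw [mul_add]
  refine add_mem (W.Low_le_Err _ _ (W.Low_mono (by omega) (W.mul_mem_Low hY hA))) ?_
  clear hP
  induction hB using Submodule.span_induction with
  | mem P hP => obtain ⟨i, t, w, ht, hw, rfl⟩ := hP; exact h i t w ht hw
  | zero => simp
  | add P Q hP hQ h₁ h₂ => rw [mul_add]; exact add_mem h₁ h₂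
  | smul a P hP hh =>
    rw [← sub_add_cancel (Y * (a • P)) (a • (Y * P))]
    refine add_mem (W.Low_le_Err _ _ (W.Ord_le_Low _ ?_)) (Submodule.smul_mem _ _ hh)
    exact W.Ord_mono (by omega)
      (W.mul_smul_sub_mem_Ord a hY (W.Err_le_Ord q p (Submodule.mem_sup_right hP)))

lemma T_mul_mem_Err (a : ι × ι) {q p : ℕ} {P : Module.End ℝ S} (hP : P ∈ W.Err q p) :
    W.T a * P ∈ W.Err (q + 1) p := by
  refine W.mul_mem_Err_of_generators (W.T_mem_Ord a) (by omega) (fun i t w ht hw => ?_) hP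
  have : W.T a * (W.D i * (W.tang t * W.word w)) = (W.T a * W.D i - W.D i * W.T a)
      * (W.tang t * W.word w) + W.D i * (W.tang (a :: t) * W.word w) := by
    rw [sub_mul, tang_cons]; simp only [mul_assoc]; abel
  rw [this]
  refine add_mem (W.Low_le_Err _ _ (W.Ord_le_Low _ (W.Ord_mono ?_ (W.mul_mem_Ord
    (W.commutator_mem_Ord (W.T_mem_Ord a) (W.D_mem_Ord i)) (W.tang_mul_word_mem_Ord t w)))))
    (W.mem_Err i (by simp [ht]) hw)
  push_cast; omega

lemma D_mul_mem_Err (m : ι) {q p : ℕ} {P : Module.End ℝ S} (hP : P ∈ W.Err q p) :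
    W.D m * P ∈ W.Err q (p + 1) := by
  refine W.mul_mem_Err_of_generators (W.D_mem_Ord m) (by omega) (fun i t w ht hw => ?_) hP
  have : W.D m * (W.D i * (W.tang t * W.word w)) = W.D i * ((W.D m * W.tang t - W.tang t * W.D m)
      * W.word w) + W.D i * (W.tang t * W.word (m :: w)) := by
    rw [← mul_assoc, D_comm, sub_mul, word_cons, mul_sub]; simp only [mul_assoc]; abel
  rw [this]
  refine add_mem (W.Low_le_Err _ _ (W.Ord_le_Low _ (W.Ord_mono ?_ (W.D_mul_mem_Ord i
    (W.mul_mem_Ord (W.commutator_mem_Ord (W.D_mem_Ord m) (W.tang_mem_Ord t))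
      (W.word_mem_Ord (w := w) le_rfl)))))) (W.mem_Err i ht (by simp [hw]))
  push_cast; omega

lemma mul_word_mem_Err {q : ℕ} {P : Module.End ℝ S} (hP : P ∈ W.Err q 1) (w : List ι) :
    P * W.word w ∈ W.Err q (w.length + 1) := by
  obtain ⟨A, hA, B, hB, rfl⟩ := Submodule.mem_sup.mp hP
  rw [add_mul]
  refine add_mem (W.Low_le_Err _ _ (W.Low_mono (by push_cast; omega)
    (W.Low_mul_mem hA (W.word_mem_Ord (w := w) le_rfl)))) ?_
  clear hP
  induction hB using Submodule.span_induction with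
  | mem P hP =>
    obtain ⟨i, t, v, ht, hv, rfl⟩ := hP
    obtain rfl : v = [] := List.length_eq_zero_iff.mp (by omega)
    rw [word_nil, mul_one, mul_assoc]
    exact W.mem_Err i ht rfl
  | zero => simp
  | add P Q hP hQ h₁ h₂ => rw [add_mul]; exact add_mem h₁ h₂
  | smul a P hP hh => rw [smul_mul_assoc]; exact Submodule.smul_mem _ _ hh

lemma M_D_mem_Err (γ : ℝ) (m : ι) : W.M (γ + 1) * W.D m - W.D m * W.M γ ∈ W.Err 0 1 := by
  have key : W.N * W.D m - W.d m W.r • W.divFlux ∈ W.Err 0 1 := by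
    have e : W.N * W.D m - W.d m W.r • W.divFlux = ∑ i, ∑ j,
        (-(W.G i j • (W.T (m, i) * W.D j - W.D j * W.T (m, i)))
          - (W.d m W.r * W.d i (W.G i j)) • W.D j
          - W.G i j • (W.D j * (W.tang [(m, i)] * W.word []))) := by
      simp only [N, divFlux, flux, Finset.sum_mul, Finset.smul_sum, Finset.mul_sum,
        ← Finset.sum_sub_distrib]
      refine Finset.sum_congr rfl fun i _ => Finset.sum_congr rfl fun j _ => ?_
      simp only [tang_cons, tang_nil, word_nil, mul_one, D_mul_smul, T, sub_mul, smul_mul_assoc,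
        smul_add, smul_sub, smul_smul, W.D_comm j m, mul_comm]
      abel
    rw [e]
    refine sum_mem fun i _ => sum_mem fun j _ => sub_mem (sub_mem (neg_mem ?_) ?_) ?_
    · exact W.Low_le_Err _ _ (W.Ord_le_Low _ (Submodule.smul_mem _ _ (W.Ord_mono (by simp)
        (W.commutator_mem_Ord (W.T_mem_Ord (m, i)) (W.D_mem_Ord j)))))
    · exact W.Low_le_Err _ _ (W.Ord_le_Low _ (Submodule.smul_mem _ _ (W.Ord_mono (by simp)
        (W.D_mem_Ord j))))
    · exact Submodule.smul_mem _ _ (W.mem_Err j rfl rfl)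
  have : W.M (γ + 1) * W.D m - W.D m * W.M γ =
      (W.r • (W.divFlux * W.D m - W.D m * W.divFlux) + γ • (W.N * W.D m - W.D m * W.N))
        + (W.N * W.D m - W.d m W.r • W.divFlux) := by
    simp only [M, add_mul, mul_add, smul_mul_assoc, mul_smul_comm, D_mul_smul, smul_sub, add_smul,
      one_smul]
    abel
  rw [this]
  refine add_mem (W.Low_le_Err _ _ (add_mem (W.smul_mem_Low (W.Ord_mono ?_
    (W.commutator_mem_Ord W.divFlux_mem_Ord (W.D_mem_Ord m)))) (W.Ord_le_Low _ (real_smul_mem γ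
      (W.Ord_mono ?_ (W.commutator_mem_Ord W.N_mem_Ord (W.D_mem_Ord m))))))) key <;> simp

/-- Each derivative raises the parameter of `M` by one, up to admissible errors. -/
lemma M_mul_sub_mul_M_mem_Err (α : ℝ) (t : List (ι × ι)) (w : List ι) :
    W.M (α + w.length) * (W.tang t * W.word w) - W.tang t * W.word w * W.M α
      ∈ W.Err t.length w.length := by
  induction t with
  | nil =>
    simp only [tang_nil, one_mul]
    induction w with
    | nil => simp [word_nil]
    | cons m w ih =>
      have : W.M (α + (m :: w).length) * W.word (m :: w) - W.word (m :: w) * W.M α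
          = W.D m * (W.M (α + w.length) * W.word w - W.word w * W.M α)
            + (W.M (α + w.length + 1) * W.D m - W.D m * W.M (α + w.length)) * W.word w := by
        rw [List.length_cons, Nat.cast_succ, ← add_assoc, word_cons, mul_sub, sub_mul]
        simp only [mul_assoc]; abel
      rw [this]
      exact add_mem (W.D_mul_mem_Err m ih) (W.mul_word_mem_Err (W.M_D_mem_Err _ m) w)
  | cons a t ih =>
    have : W.M (α + w.length) * (W.tang (a :: t) * W.word w)
        - W.tang (a :: t) * W.word w * W.M α
        = W.T a * (W.M (α + w.length) * (W.tang t * W.word w) - W.tang t * W.word w * W.M α)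
          + (W.M (α + w.length) * W.T a - W.T a * W.M (α + w.length))
            * (W.tang t * W.word w) := by
      rw [tang_cons, mul_sub, sub_mul]; simp only [mul_assoc]; abel
    rw [this]
    refine add_mem (W.T_mul_mem_Err a ih) (W.Low_le_Err _ _ (W.Low_mono ?_ (W.Low_mul_mem
      (W.commutator_M_T_mem_Low _ a) (W.tang_mul_word_mem_Ord t w))))
    push_cast [List.length_cons]; omega

/-- The operators `P` for which `∫ r ^ p |P f|²` is controlled by `K f`. -/
def Dom (K : S → ℝ) (p : ℝ) (hp : -1 < p) :
    Submodule S (Module.End ℝ S) where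
  carrier := {P | ∃ C ≥ 0, ∀ f, W.I p (P f ^ 2) ≤ C * K f}
  zero_mem' := ⟨0, le_rfl, fun f => by simp⟩
  add_mem' := by
    rintro P Q ⟨C, hC, h⟩ ⟨C', hC', h'⟩
    refine ⟨2 * C + 2 * C', by positivity, fun f => ?_⟩
    have : W.I p ((P f + Q f) ^ 2) ≤ W.I p ((2 : ℝ) • P f ^ 2 + (2 : ℝ) • Q f ^ 2) := by
      refine W.I_mono hp fun x => ?_
      simp only [map_add, map_pow, map_smul, smul_eq_mul]
      nlinarith [sq_nonneg (W.ev x (P f) - W.ev x (Q f))]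
    simp only [map_add, map_smul, smul_eq_mul] at this
    have h₁ := h f
    have h₂ := h' f
    simp only [LinearMap.add_apply]
    linarith
  smul_mem' := by
    rintro a P ⟨C, hC, h⟩
    obtain ⟨A, hA, h'⟩ := W.I_sq_mul_le a hp
    refine ⟨A * C, by positivity, fun f => ?_⟩
    rw [mul_assoc]
    exact (h' (P f)).trans (by gcongr; exact h f)

variable {K : S → ℝ} {p : ℝ} {hp : -1 < p} {P : Module.End ℝ S}

lemma mem_Dom_of_add_one (h : P ∈ W.Dom K p hp) {q : ℝ} (hq : q = p + 1) :
    P ∈ W.Dom K q (by linarith) := by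
  subst hq
  obtain ⟨C, hC, h⟩ := h
  obtain ⟨R, hR, h'⟩ := W.exists_I_succ_le
  refine ⟨R * C, by positivity, fun f => ?_⟩
  rw [mul_assoc]
  exact (h' p hp _ fun x => by simpa using sq_nonneg _).trans (by gcongr; exact h f)

lemma mem_Dom_of_add_two (h : P ∈ W.Dom K p hp) {q : ℝ} (hq : q = p + 2) :
    P ∈ W.Dom K q (by linarith) :=
  W.mem_Dom_of_add_one (W.mem_Dom_of_add_one h rfl) (by linarith)

lemma r_smul_mem_Dom {q : ℝ} {hq : -1 < q} (h : P ∈ W.Dom K q hq) (hpq : q = p + 2) :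
    W.r • P ∈ W.Dom K p hp := by
  subst hpq
  obtain ⟨C, hC, h⟩ := h
  refine ⟨C, hC, fun f => ?_⟩
  rw [LinearMap.smul_apply, smul_eq_mul, mul_pow, W.I_mul_r_sq hp]
  exact h f

lemma exists_I_grad2_le_of_mem_Dom (h : ∀ i, W.D i * P ∈ W.Dom K p hp) :
    ∃ C ≥ 0, ∀ f, W.I p (W.grad2 (P f)) ≤ C * K f := by
  choose C hC h using h
  refine ⟨∑ i, C i, Finset.sum_nonneg fun i _ => hC i, fun f => ?_⟩
  rw [grad2, map_sum, Finset.sum_mul]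
  exact Finset.sum_le_sum fun i _ => h i f

lemma D_mul_mem_Dom {C : ℝ} (hC : 0 ≤ C) (h : ∀ f, W.I p (W.grad2 (P f)) ≤ C * K f) (i : ι) :
    W.D i * P ∈ W.Dom K p hp :=
  ⟨C, hC, fun f => (W.I_single_le_grad2 hp i (P f)).trans (h f)⟩

lemma mem_Dom_of_hardy {q : ℝ} {hq : -1 < q} (hpq : q = p + 2) (h : P ∈ W.Dom K q hq)
    (h' : ∀ i, W.D i * P ∈ W.Dom K q hq) : P ∈ W.Dom K p hp := by
  subst hpq
  obtain ⟨C, hC, h⟩ := h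
  obtain ⟨C', hC', h'⟩ := W.exists_I_grad2_le_of_mem_Dom h'
  obtain ⟨A, hA, hh⟩ := W.hardy hp
  refine ⟨A * (C + C'), by positivity, fun f => (hh (P f)).trans ?_⟩
  rw [mul_assoc, add_mul]
  exact mul_le_mul_of_nonneg_left (add_le_add (h f) (h' f)) hA

lemma mem_Dom_of_multiplier {q : ℝ} {hq : -1 < q} (hpq : q = p + 2) {γ : ℝ} (hγ : p + 1 ≤ γ)
    (h : W.M γ * P ∈ W.Dom K p hp) (h' : ∀ i, W.D i * P ∈ W.Dom K q hq) (i : ι) :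
    W.D i * P ∈ W.Dom K p hp := by
  subst hpq
  obtain ⟨C, hC, h⟩ := h
  obtain ⟨C', hC', h'⟩ := W.exists_I_grad2_le_of_mem_Dom h'
  obtain ⟨A, hA, hh⟩ := W.multiplier hp hγ
  refine W.D_mul_mem_Dom (C := A * (C + C')) (by positivity) (fun f => (hh (P f)).trans ?_) i
  rw [mul_assoc, add_mul]
  exact mul_le_mul_of_nonneg_left (add_le_add (h f) (h' f)) hA

lemma mem_Dom_of_interior {q : ℝ} {hq : -1 < q} (hpq : q = p + 2)
    (h : W.r • W.divFlux * P ∈ W.Dom K p hp) (h' : ∀ i, W.D i * P ∈ W.Dom K p hp)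
    (i k : ι) : W.D i * (W.D k * P) ∈ W.Dom K q hq := by
  subst hpq
  obtain ⟨C, hC, h⟩ := h
  obtain ⟨C', hC', h'⟩ := W.exists_I_grad2_le_of_mem_Dom h'
  obtain ⟨A, hA, hh⟩ := W.interior hp k
  refine W.D_mul_mem_Dom (C := A * (C + C')) (by positivity) (fun f => (hh (P f)).trans ?_) i
  rw [mul_assoc, add_mul]
  exact mul_le_mul_of_nonneg_left (add_le_add (h f) (h' f)) hA

lemma Ord_mul_mem_Dom {n : ℤ} {L : Module.End ℝ S}
    (h : ∀ w : List ι, (w.length : ℤ) ≤ n → W.word w * L ∈ W.Dom K p hp)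
    (hP : P ∈ W.Ord n) : P * L ∈ W.Dom K p hp := by
  induction hP using Submodule.span_induction with
  | mem P h' => obtain ⟨w, hw, rfl⟩ := h'; exact h w hw
  | zero => rw [zero_mul]; exact zero_mem _
  | add P Q hP hQ h₁ h₂ => rw [add_mul]; exact add_mem h₁ h₂
  | smul a P hP h => rw [smul_mul_assoc]; exact Submodule.smul_mem _ _ h

lemma Ord_succ_le_Dom {n : ℕ} (h : W.Ord n ≤ W.Dom K p hp)
    (h' : ∀ i, ∀ w : List ι, w.length = n → W.D i * W.word w ∈ W.Dom K p hp) :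
    W.Ord (n + 1 : ℕ) ≤ W.Dom K p hp := by
  refine W.Ord_le fun w hw => ?_
  rcases (Nat.cast_le.mp hw).lt_or_eq with hlt | heq
  · exact h (W.word_mem_Ord (by omega))
  · cases w with
    | nil => simp at heq
    | cons i w => rw [word_cons]; exact h' i w (by simpa using heq)

/-- Two more interior derivatives. -/
lemma interior_step (α : ℝ) {q : ℝ} {hq : -1 < q} (hpq : q = p + 2) (v : List ι)
    (h : W.Ord (v.length + 1 : ℕ) ≤ W.Dom K p hp)
    (hL : W.word v * (1 - W.M α) ∈ W.Dom K p hp) (i k : ι) :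
    W.D i * W.word (k :: v) ∈ W.Dom K q hq := by
  rw [word_cons]
  have h1 : ∀ i, W.D i * W.word v ∈ W.Ord (v.length + 1 : ℕ) := fun i => by
    rw [← word_cons]; exact W.word_mem_Ord (by simp)
  refine W.mem_Dom_of_interior hpq ?_ (fun i => h (h1 i)) i k
  have := W.M_mul_sub_mul_M_mem_Err α [] v
  rw [tang_nil, one_mul] at this
  have e : W.r • W.divFlux * W.word v = (W.M (α + v.length) * W.word v - W.word v * W.M α)
      + W.word v - W.word v * (1 - W.M α) - (α + v.length) • (W.N * W.word v) := by
    rw [mul_sub, mul_one, M, add_mul, smul_mul_assoc (α + _)]; abel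
  rw [e]
  refine sub_mem (sub_mem (add_mem (h ?_) (h (W.word_mem_Ord (by simp)))) hL)
    (real_smul_mem _ (h ?_))
  · simpa using W.Err_le_Ord _ _ this
  · exact W.Ord_mono (by push_cast; omega)
      (W.mul_mem_Ord W.N_mem_Ord (W.word_mem_Ord (w := v) le_rfl))

/-- Derivatives up to order `k` with the weight `α - 1`. -/
lemma Ord_le_Dom_of_low {α : ℝ} (hα : 0 < α) {n : ℕ} (hp : -1 < α - 1)
    (hL : ∀ w : List ι, w.length ≤ n → W.word w * (1 - W.M α) ∈ W.Dom K (α - 1) hp) (k : ℕ)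
    (hk : k ≤ n + 1) : W.Ord k ≤ W.Dom K (α - 1) hp := by
  have hq : -1 < α - 1 + 2 := by linarith
  obtain ⟨A, hA, hE⟩ := W.energy hα
  obtain ⟨C, hC, hL0⟩ := hL [] (Nat.zero_le _)
  have hL0' : ∀ f, A * W.I (α - 1) ((f - W.M α f) ^ 2) ≤ A * C * K f := fun f => by
    rw [mul_assoc]; exact mul_le_mul_of_nonneg_left (hL0 f) hA
  have hone : (1 : Module.End ℝ S) ∈ W.Dom K (α - 1) hp :=
    ⟨A * C, by positivity, fun f => (hE f).1.trans (hL0' f)⟩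
  have hD : ∀ i, W.D i * 1 ∈ W.Dom K α (by linarith) :=
    W.D_mul_mem_Dom (C := A * C) (by positivity) fun f => (hE f).2.trans (hL0' f)
  induction k with
  | zero =>
    refine W.Ord_le fun w hw => ?_
    obtain rfl : w = [] := List.length_eq_zero_iff.mp (by simpa using hw)
    exact hone
  | succ k ih =>
    have ih := ih (by omega)
    have hint : ∀ i, ∀ v : List ι, v.length = k →
        W.D i * W.word v ∈ W.Dom K (α - 1 + 2) hq := by
      intro i v hv
      cases v with
      | nil => exact W.mem_Dom_of_add_one (hD i) (by ring)
      | cons m v =>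
        simp only [List.length_cons] at hv
        exact W.interior_step α rfl v (hv ▸ ih) (hL v (by omega)) i m
    have hint' : W.Ord (k + 1 : ℕ) ≤ W.Dom K (α - 1 + 2) hq :=
      W.Ord_succ_le_Dom (fun P hP => W.mem_Dom_of_add_two (ih hP) rfl) hint
    have hlow : W.Low k ≤ W.Dom K (α - 1) hp := fun P hP => by
      obtain ⟨B, hB, B', hB', rfl⟩ := W.mem_Low.mp hP
      exact add_mem (ih hB) (W.r_smul_mem_Dom (hint' (by exact_mod_cast hB')) rfl)
    have stage : ∀ p ≤ k, ∀ (t : List (ι × ι)) (w : List ι), t.length + w.length = k →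
        w.length = p → ∀ i, W.D i * (W.tang t * W.word w) ∈ W.Dom K (α - 1) hp := by
      intro p
      induction p with
      | zero | succ p ihp =>
        intro hpk t w htw hwp i
        have hV : W.tang t * W.word w ∈ W.Ord k :=
          W.Ord_mono (by omega) (W.tang_mul_word_mem_Ord t w)
        refine W.mem_Dom_of_multiplier (γ := α + w.length) rfl
          (by linarith [w.length.cast_nonneg (α := ℝ)]) ?_ (fun i => hint' ?_) i
        · have hM := W.M_mul_sub_mul_M_mem_Err α t w
          have e : W.M (α + w.length) * (W.tang t * W.word w) =
              (W.M (α + w.length) * (W.tang t * W.word w) - W.tang t * W.word w * W.M α)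
              + (W.tang t * W.word w - W.tang t * W.word w * (1 - W.M α)) := by
            rw [mul_sub, mul_one]; abel
          rw [e]
          refine add_mem (W.Err_le ?_ ?_ hM) (sub_mem (ih hV) (W.Ord_mul_mem_Dom
            (fun v hv => hL v (by omega)) hV))
          · rw [← Nat.cast_add, htw]; exact hlow
          · intro i t' w' ht' hw'
            first
            | omega
            | exact ihp (by omega) t' w' (by omega) (by omega) i
        · simpa using W.D_mul_mem_Ord i hV
    refine W.Ord_succ_le_Dom ih fun i w hw => ?_
    simpa [tang_nil] using stage k le_rfl [] w (by simpa using hw) hw i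

/-- Derivatives up to order `2 n + 2` with the weight `α - 1 + 2 (n + 1)`. -/
lemma Ord_le_Dom_of_high {α : ℝ} (hα : 0 < α) {n : ℕ} (hp : ∀ j : ℕ, -1 < α - 1 + 2 * j)
    (hL : ∀ w : List ι, w.length ≤ n + n →
      W.word w * (1 - W.M α) ∈ W.Dom K (α - 1 + 2 * n) (hp n)) :
    W.Ord (n + 1 + (n + 1) : ℕ) ≤ W.Dom K (α - 1 + 2 * (n + 1 : ℕ)) (hp (n + 1)) := by
  have hL' : ∀ j ≤ n, ∀ w : List ι, w.length ≤ n + j →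
      W.word w * (1 - W.M α) ∈ W.Dom K (α - 1 + 2 * j) (hp j) := by
    intro j hj
    induction hj using Nat.decreasingInduction with
    | self => exact hL
    | of_succ j hj ih =>
      intro w hw
      refine W.mem_Dom_of_hardy (q := α - 1 + 2 * (j + 1 : ℕ)) (hq := hp _) (by push_cast; ring)
        (ih w (by omega)) fun i => ?_
      rw [← mul_assoc, ← word_cons]
      exact ih _ (by simp; omega)
  have main : ∀ j ≤ n + 1, W.Ord (n + 1 + j : ℕ) ≤ W.Dom K (α - 1 + 2 * j) (hp j) := by
    intro j
    induction j with
    | zero =>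
      intro _
      have h0 : -1 < α - 1 := by linarith
      have := W.Ord_le_Dom_of_low (K := K) hα h0 (n := n)
        (by simpa using hL' 0 (Nat.zero_le _)) (n + 1) le_rfl
      simpa using this
    | succ j ih =>
      intro hj
      have ih := ih (by omega)
      have e : α - 1 + 2 * (j + 1 : ℕ) = α - 1 + 2 * j + 2 := by push_cast; ring
      refine W.Ord_succ_le_Dom (n := n + 1 + j) (fun P hP => W.mem_Dom_of_add_two (ih hP) e) ?_
      intro i w hw
      cases w with
      | nil => simp at hw; omega
      | cons k v =>
        simp only [List.length_cons] at hw
        refine W.interior_step α e v (fun P hP => ih (W.Ord_mono ?_ hP))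
          (hL' j (by omega) v (by omega)) i k
        exact_mod_cast (by omega)
  exact main (n + 1) le_rfl

/-- The high order estimate for `1 - M α`. -/
theorem high_order_estimate {α : ℝ} (hα : 0 < α) (n : ℕ) : ∃ C > 0, ∀ f,
    ∑ k ∈ Finset.range (2 * n + 3), ∑ b : Fin k → ι,
        W.I (α - 1 + 2 * (n + 1 : ℕ)) (W.word (List.ofFn b) f ^ 2)
      ≤ C * ∑ k ∈ Finset.range (2 * n + 1), ∑ b : Fin k → ι,
        W.I (α - 1 + 2 * n) (W.word (List.ofFn b) (f - W.M α f) ^ 2) := by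
  have hp : ∀ j : ℕ, -1 < α - 1 + 2 * j := fun j => by
    linarith [j.cast_nonneg (α := ℝ)]
  obtain ⟨K, hKdef⟩ : ∃ K : S → ℝ, K = fun f => ∑ k ∈ Finset.range (2 * n + 1),
    ∑ b : Fin k → ι, W.I (α - 1 + 2 * n) (W.word (List.ofFn b) (f - W.M α f) ^ 2) := ⟨_, rfl⟩
  have hpos : ∀ (k : ℕ) (b : Fin k → ι) f,
      0 ≤ W.I (α - 1 + 2 * n) (W.word (List.ofFn b) (f - W.M α f) ^ 2) :=
    fun k b f => W.I_sq_nonneg (hp n) _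
  have hK : ∀ f, 0 ≤ K f := fun f => by
    rw [hKdef]
    exact Finset.sum_nonneg fun k _ => Finset.sum_nonneg fun b _ => hpos k b f
  have h := W.Ord_le_Dom_of_high (K := K) hα (n := n) hp fun w hw => by
    refine ⟨1, zero_le_one, fun f => ?_⟩
    rw [one_mul, hKdef]
    refine le_trans ?_ (Finset.single_le_sum (f := fun k => ∑ b : Fin k → ι,
      W.I (α - 1 + 2 * n) (W.word (List.ofFn b) (f - W.M α f) ^ 2))
      (fun k _ => Finset.sum_nonneg fun b _ => hpos k b f)
      (Finset.mem_range.mpr (show w.length < 2 * n + 1 by omega)))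
    refine le_of_eq_of_le ?_ (Finset.single_le_sum (f := fun b : Fin w.length → ι =>
      W.I (α - 1 + 2 * n) (W.word (List.ofFn b) (f - W.M α f) ^ 2))
      (fun b _ => hpos _ b f) (Finset.mem_univ w.get))
    rw [List.ofFn_get]; rfl
  have h' : ∀ (k : ℕ) (b : Fin k → ι), ∃ C ≥ 0, k ∈ Finset.range (2 * n + 3) →
      ∀ f, W.I (α - 1 + 2 * (n + 1 : ℕ)) (W.word (List.ofFn b) f ^ 2) ≤ C * K f := by
    intro k b
    by_cases hk : k ∈ Finset.range (2 * n + 3)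
    · obtain ⟨C, hC, hh⟩ := h (W.word_mem_Ord (w := List.ofFn b) (by
        have := Finset.mem_range.mp hk
        rw [List.length_ofFn]; omega))
      exact ⟨C, hC, fun _ => hh⟩
    · exact ⟨0, le_rfl, fun hk' => absurd hk' hk⟩
  choose C hC hh using h'
  refine ⟨(∑ k ∈ Finset.range (2 * n + 3), ∑ b : Fin k → ι, C k b) + 1, add_pos_of_nonneg_of_pos
    (Finset.sum_nonneg fun k _ => Finset.sum_nonneg fun b _ => hC k b) one_pos, fun f => ?_⟩
  have e := congrFun hKdef f
  beta_reduce at e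
  rw [← e, add_mul, one_mul, Finset.sum_mul]
  refine le_add_of_le_of_nonneg (Finset.sum_le_sum fun k hk => ?_) (hK f)
  rw [Finset.sum_mul]
  exact Finset.sum_le_sum fun b _ => hh k b hk f

end WeightedCalculus

open Filter Topology

/-- The closure of a domain with smooth boundary is a set of unique differentiability. -/
lemma HasSmoothBoundary.uniqueDiffOn_closure {n : ℕ} {Ω : Set (Fin n → ℝ)}
    (h : HasSmoothBoundary Ω) (ho : IsOpen Ω) : UniqueDiffOn ℝ (closure Ω) := by
  obtain ⟨ρ, hρ, hΩ, hf⟩ := h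
  intro x hx
  by_cases hxΩ : x ∈ Ω
  · exact (ho.uniqueDiffWithinAt hxΩ).mono subset_closure
  obtain ⟨hρ0, hρ'⟩ := hf x ⟨hx, fun h => hxΩ (interior_subset h)⟩
  have hd : HasFDerivAt ρ (fderiv ℝ ρ x) x :=
    (hρ.differentiable (by simp) x).hasFDerivAt
  have hcone : ∀ v, 0 < fderiv ℝ ρ x v → v ∈ tangentConeAt ℝ (closure Ω) x := by
    intro v hv
    refine mem_tangentConeAt_of_add_smul_mem (l := 𝓝[>] (0 : ℝ)) (c := id)
      (tendsto_id'.mpr (nhdsWithin_mono _ fun t (ht : 0 < t) => ht.ne')) ?_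
    have hl : HasDerivAt (fun t : ℝ => ρ (x + t • v)) (fderiv ℝ ρ x v) 0 := by
      have := hd.hasLineDerivAt v
      exact this
    have := (hasDerivAt_iff_tendsto_slope.mp hl).mono_left
      (nhdsWithin_mono _ fun t (ht : 0 < t) => ht.ne')
    filter_upwards [this.eventually (lt_mem_nhds hv), self_mem_nhdsWithin] with t ht (ht0 : 0 < t)
    refine subset_closure ?_
    rw [hΩ]
    simp only [slope_def_field, sub_zero, zero_smul, add_zero, hρ0] at ht
    exact (div_pos_iff_of_pos_right ht0).mp ht
  obtain ⟨v, hv⟩ : ∃ v, 0 < fderiv ℝ ρ x v := by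
    obtain ⟨w, hw⟩ : ∃ w, fderiv ℝ ρ x w ≠ 0 := by
      by_contra! h'
      exact hρ' (ContinuousLinearMap.ext h')
    rcases hw.lt_or_gt with h | h
    · exact ⟨-w, by simpa using h⟩
    · exact ⟨w, h⟩
  refine ⟨?_, subset_closure hx⟩
  have htop : Submodule.span ℝ (tangentConeAt ℝ (closure Ω) x) = ⊤ := by
    refine Submodule.eq_top_iff'.mpr fun w => ?_
    obtain ⟨t, ht⟩ : ∃ t : ℝ, 0 < fderiv ℝ ρ x (w + t • v) := by
      refine ⟨(1 - fderiv ℝ ρ x w) / fderiv ℝ ρ x v, ?_⟩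
      simp [div_mul_cancel₀ _ hv.ne']
    have := sub_mem (Submodule.subset_span (hcone _ ht))
      (Submodule.smul_mem _ t (Submodule.subset_span (hcone v hv)))
    simpa using this
  rw [htop]
  exact dense_univ

/-- Functions which are smooth on `K` up to the boundary. -/
def smoothAlgebra {n : ℕ} (K : Set (Fin n → ℝ)) : Subalgebra ℝ ((Fin n → ℝ) → ℝ) where
  carrier := {f | ContDiffOn ℝ (⊤ : ℕ∞) f K}
  mul_mem' hf hg := hf.mul hg
  add_mem' hf hg := hf.add hg
  algebraMap_mem' c := contDiffOn_const (c := c)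

lemma contDiffOn_fderivWithin_apply_const {n : ℕ} {K : Set (Fin n → ℝ)} (hK : UniqueDiffOn ℝ K)
    {f : (Fin n → ℝ) → ℝ} (hf : ContDiffOn ℝ (⊤ : ℕ∞) f K) (v : Fin n → ℝ) :
    ContDiffOn ℝ (⊤ : ℕ∞) (fun x => fderivWithin ℝ f K x v) K :=
  (hf.fderivWithin hK (by simp)).clm_apply contDiffOn_const

/-- Partial derivatives as derivations of the algebra of functions smooth up to the boundary. -/
noncomputable def smoothDerivation {n : ℕ} {K : Set (Fin n → ℝ)} (hKc : IsClosed K)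
    (hK : UniqueDiffOn ℝ K) (i : Fin n) : Derivation ℝ (smoothAlgebra K) (smoothAlgebra K) :=
  have hd : ∀ f : smoothAlgebra K, ∀ x ∈ K, DifferentiableWithinAt ℝ f.1 K x :=
    fun f => ContDiffOn.differentiableOn f.2 (by simp)
  Derivation.mk'
    { toFun := fun f => ⟨fun x => fderivWithin ℝ f.1 K x (Pi.single i 1),
        contDiffOn_fderivWithin_apply_const hK f.2 _⟩
      map_add' := fun f g => by
        ext x
        by_cases hx : x ∈ K
        · simp [fderivWithin_add (hK x hx) (hd f x hx) (hd g x hx)]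
        · simp [fderivWithin_zero_of_notMem_closure (hKc.closure_eq.symm ▸ hx)]
      map_smul' := fun c f => by
        ext x
        by_cases hx : x ∈ K
        · simp [fderivWithin_const_smul (hK x hx) (hd f x hx)]
        · simp [fderivWithin_zero_of_notMem_closure (hKc.closure_eq.symm ▸ hx)] }
    fun f g => by
      ext x
      by_cases hx : x ∈ K
      · simp [fderivWithin_mul (hK x hx) (hd f x hx) (hd g x hx)]
      · simp [fderivWithin_zero_of_notMem_closure (hKc.closure_eq.symm ▸ hx)]

lemma smoothDerivation_apply {n : ℕ} {K : Set (Fin n → ℝ)} (hKc : IsClosed K)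
    (hK : UniqueDiffOn ℝ K) (i : Fin n) (f : smoothAlgebra K) (x : Fin n → ℝ) :
    (smoothDerivation hKc hK i f).1 x = fderivWithin ℝ f.1 K x (Pi.single i 1) := rfl

lemma smoothDerivation_comm {n : ℕ} {K : Set (Fin n → ℝ)} (hKc : IsClosed K)
    (hK : UniqueDiffOn ℝ K) (hKi : K ⊆ closure (interior K)) (i j : Fin n) (f : smoothAlgebra K) :
    smoothDerivation hKc hK i (smoothDerivation hKc hK j f)
      = smoothDerivation hKc hK j (smoothDerivation hKc hK i f) := by
  ext x
  simp only [smoothDerivation_apply]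
  by_cases hx : x ∈ K
  · have hs := (ContDiffOn.contDiffWithinAt f.2 hx).isSymmSndFDerivWithinAt
      (by simpa using WithTop.coe_le_coe.mpr (le_top (a := (2 : ℕ∞)))) hK (hKi hx) hx
    have hd : DifferentiableWithinAt ℝ (fderivWithin ℝ f.1 K) K x :=
      (ContDiffOn.fderivWithin f.2 hK (m := (⊤ : ℕ∞)) (by simp)).differentiableOn (by simp) x hx
    have key : ∀ k, fderivWithin ℝ (smoothDerivation hKc hK k f).1 K x
        = (ContinuousLinearMap.apply ℝ ℝ (Pi.single k 1)).comp
          (fderivWithin ℝ (fderivWithin ℝ f.1 K) K x) := fun k =>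
      (((ContinuousLinearMap.apply ℝ ℝ (Pi.single k 1)).hasFDerivAt).comp_hasFDerivWithinAt
        (f := fderivWithin ℝ f.1 K) x hd.hasFDerivWithinAt).fderivWithin (hK x hx)
    rw [key, key]
    exact hs _ _
  · simp [fderivWithin_zero_of_notMem_closure (hKc.closure_eq.symm ▸ hx)]

lemma integrable_of_tendsto_of_integral_le {α : Type*} [MeasurableSpace α] {μ : Measure α}
    {G : ℕ → α → ℝ} {f : α → ℝ} {C : ℝ} (hG : ∀ n, Integrable (G n) μ)
    (h0 : ∀ n, 0 ≤ᵐ[μ] G n) (hC : ∀ n, ∫ x, G n x ∂μ ≤ C)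
    (hlim : ∀ᵐ x ∂μ, Tendsto (fun n => G n x) atTop (𝓝 (f x))) : Integrable f μ := by
  refine ⟨aestronglyMeasurable_of_tendsto_ae _ (fun n => (hG n).aestronglyMeasurable) hlim, ?_⟩
  have h1 : ∀ n, ∫⁻ x, ‖G n x‖ₑ ∂μ ≤ ENNReal.ofReal C := fun n => by
    rw [← ofReal_integral_norm_eq_lintegral_enorm (hG n)]
    refine ENNReal.ofReal_le_ofReal (le_of_eq_of_le (integral_congr_ae ?_) (hC n))
    filter_upwards [h0 n] with x hx using Real.norm_of_nonneg hx
  calc ∫⁻ x, ‖f x‖ₑ ∂μ = ∫⁻ x, liminf (fun n => ‖G n x‖ₑ) atTop ∂μ :=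
        lintegral_congr_ae (by filter_upwards [hlim] with x hx using hx.enorm.liminf_eq.symm)
    _ ≤ liminf (fun n => ∫⁻ x, ‖G n x‖ₑ ∂μ) atTop :=
        lintegral_liminf_le' fun n => (hG n).aestronglyMeasurable.aemeasurable.enorm
    _ ≤ ENNReal.ofReal C := liminf_le_of_le ⟨0, by simp⟩ fun b hb => by
        obtain ⟨n, hn⟩ := hb.exists
        exact hn.trans (h1 n)
    _ < ⊤ := ENNReal.ofReal_lt_top

/-- A continuous truncation of `s ^ p` which vanishes for `s ≤ ε`. -/
noncomputable def cutoffPow (p ε s : ℝ) : ℝ := max s ε ^ p * max 0 (min 1 (s / ε - 1))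

section cutoffPow

variable {p ε : ℝ}

lemma continuous_cutoffPow (hε : 0 < ε) : Continuous (cutoffPow p ε) := by
  refine Continuous.mul (Continuous.rpow_const (by fun_prop) fun s => Or.inl ?_) (by fun_prop)
  exact (hε.trans_le (le_max_right _ _)).ne'

lemma cutoffPow_nonneg (hε : 0 < ε) (s : ℝ) : 0 ≤ cutoffPow p ε s :=
  mul_nonneg (Real.rpow_nonneg (hε.le.trans (le_max_right _ _)) _) (le_max_left _ _)

lemma cutoffPow_eq_zero (hε : 0 < ε) {s : ℝ} (hs : s ≤ ε) : cutoffPow p ε s = 0 := by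
  have : s / ε - 1 ≤ 0 := by rw [sub_nonpos, div_le_one hε]; exact hs
  rw [cutoffPow, max_eq_left ((min_le_right _ _).trans this), mul_zero]

lemma cutoffPow_le (hε : 0 < ε) {s : ℝ} (hs : 0 < s) : cutoffPow p ε s ≤ s ^ p := by
  rcases le_total s ε with h | h
  · rw [cutoffPow_eq_zero hε h]; exact Real.rpow_nonneg hs.le _
  · rw [cutoffPow, max_eq_left h]
    exact mul_le_of_le_one_right (Real.rpow_nonneg hs.le _) (max_le zero_le_one (min_le_left _ _))

lemma cutoffPow_eq (hε : 0 < ε) {s : ℝ} (hs : 2 * ε ≤ s) : cutoffPow p ε s = s ^ p := by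
  have : 1 ≤ s / ε - 1 := by rw [le_sub_iff_add_le, le_div_iff₀ hε]; linarith
  rw [cutoffPow, min_eq_left this, max_eq_right zero_le_one, mul_one, max_eq_left (by linarith)]

lemma tendsto_cutoffPow {ε : ℕ → ℝ} (hε : ∀ n, 0 < ε n) (hε0 : Tendsto ε atTop (𝓝 0)) {s : ℝ}
    (hs : 0 < s) : Tendsto (fun n => cutoffPow p (ε n) s) atTop (𝓝 (s ^ p)) := by
  refine tendsto_const_nhds.congr' ?_
  filter_upwards [hε0.eventually_lt_const (half_pos hs)] with n hn
  rw [cutoffPow_eq (hε n) (by linarith)]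

/-- The primitive of `cutoffPow`. -/
noncomputable def cutoffPrim (p ε t : ℝ) : ℝ := ∫ s in (0 : ℝ)..t, cutoffPow p ε s

lemma hasDerivAt_cutoffPrim (hε : 0 < ε) (t : ℝ) :
    HasDerivAt (cutoffPrim p ε) (cutoffPow p ε t) t :=
  (continuous_cutoffPow hε).integral_hasStrictDerivAt 0 t |>.hasDerivAt

lemma cutoffPrim_eq_zero (hε : 0 < ε) {t : ℝ} (ht : t ≤ ε) : cutoffPrim p ε t = 0 := by
  rw [cutoffPrim]
  refine (intervalIntegral.integral_congr fun s hs => ?_).trans intervalIntegral.integral_zero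
  exact cutoffPow_eq_zero hε (hs.2.trans (max_le hε.le ht))

lemma cutoffPrim_nonneg (hε : 0 < ε) {t : ℝ} (ht : 0 ≤ t) : 0 ≤ cutoffPrim p ε t :=
  intervalIntegral.integral_nonneg ht fun s _ => cutoffPow_nonneg hε s

lemma integral_rpow_zero_left (hp : -1 < p) (t : ℝ) :
    ∫ s in (0 : ℝ)..t, s ^ p = t ^ (p + 1) / (p + 1) := by
  rw [integral_rpow (Or.inl hp), Real.zero_rpow (by linarith), sub_zero]

lemma cutoffPrim_le (hp : -1 < p) (hε : 0 < ε) {t : ℝ} (ht : 0 ≤ t) :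
    cutoffPrim p ε t ≤ t ^ (p + 1) / (p + 1) := by
  rw [← integral_rpow_zero_left hp]
  refine intervalIntegral.integral_mono_on_of_le_Ioo ht
    ((continuous_cutoffPow hε).intervalIntegrable _ _)
    (intervalIntegral.intervalIntegrable_rpow' hp) fun s hs => cutoffPow_le hε hs.1

lemma tendsto_cutoffPrim (hp : -1 < p) {ε : ℕ → ℝ} (hε : ∀ n, 0 < ε n)
    (hε0 : Tendsto ε atTop (𝓝 0)) {t : ℝ} (ht : 0 ≤ t) :
    Tendsto (fun n => cutoffPrim p (ε n) t) atTop (𝓝 (t ^ (p + 1) / (p + 1))) := by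
  rw [← integral_rpow_zero_left hp]
  refine intervalIntegral.tendsto_integral_filter_of_dominated_convergence (fun s => s ^ p)
    (Eventually.of_forall fun n => (continuous_cutoffPow (hε n)).aestronglyMeasurable)
    (Eventually.of_forall fun n => Eventually.of_forall fun s hs => ?_)
    (intervalIntegral.intervalIntegrable_rpow' hp) (Eventually.of_forall fun s hs => ?_) <;>
  rw [uIoc_of_le ht] at hs
  · rw [Real.norm_of_nonneg (cutoffPow_nonneg (hε n) s)]
    exact cutoffPow_le (hε n) hs.1
  · exact tendsto_cutoffPow hε hε0 hs.1

end cutoffPow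

lemma integrableOn_of_continuousOn_closure {n : ℕ} {Ω : Set (Fin n → ℝ)}
    (hb : Bornology.IsBounded Ω) {g : (Fin n → ℝ) → ℝ} (hg : ContinuousOn g (closure Ω)) :
    IntegrableOn g Ω :=
  (hg.integrableOn_compact hb.isCompact_closure).mono_set subset_closure

/-- A divergence theorem for functions which vanish near the boundary. -/
lemma setIntegral_fderiv_cutoff_eq_zero {n : ℕ} {Ω : Set (Fin n → ℝ)} (ho : IsOpen Ω)
    (hb : Bornology.IsBounded Ω) (hu : UniqueDiffOn ℝ (closure Ω)) {r F : (Fin n → ℝ) → ℝ}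
    (hr : ContDiffOn ℝ (⊤ : ℕ∞) r (closure Ω)) (hF : ContDiffOn ℝ (⊤ : ℕ∞) F (closure Ω))
    (hr0 : ∀ x ∈ frontier Ω, r x = 0) {Φ φ : ℝ → ℝ} (hΦ : ∀ t, HasDerivAt Φ (φ t) t)
    (hφ : Continuous φ) {ε : ℝ} (hε : 0 < ε) (h0 : ∀ t ≤ ε, Φ t = 0) (v : Fin n → ℝ) :
    ∫ x in Ω, (φ (r x) * fderivWithin ℝ r (closure Ω) x v * F x
      + Φ (r x) * fderivWithin ℝ F (closure Ω) x v) = 0 := by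
  have hΦc : Continuous Φ := continuous_iff_continuousAt.mpr fun t => (hΦ t).continuousAt
  have hd : ∀ {f : (Fin n → ℝ) → ℝ}, ContDiffOn ℝ (⊤ : ℕ∞) f (closure Ω) → ∀ x ∈ Ω,
      HasFDerivAt f (fderivWithin ℝ f (closure Ω) x) x := fun hf x hx =>
    (hf.differentiableOn (by simp) x (subset_closure hx)).hasFDerivWithinAt.hasFDerivAt
      (mem_of_superset (ho.mem_nhds hx) subset_closure)
  have hc : ∀ {f : (Fin n → ℝ) → ℝ}, ContDiffOn ℝ (⊤ : ℕ∞) f (closure Ω) →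
      ContinuousOn (fun x => fderivWithin ℝ f (closure Ω) x v) (closure Ω) := fun hf =>
    (contDiffOn_fderivWithin_apply_const hu hf v).continuousOn
  set g : (Fin n → ℝ) → ℝ := Ω.indicator fun x => Φ (r x) * F x with hg
  set g' : (Fin n → ℝ) → ((Fin n → ℝ) →L[ℝ] ℝ) := Ω.indicator fun x =>
    Φ (r x) • fderivWithin ℝ F (closure Ω) x
      + F x • φ (r x) • fderivWithin ℝ r (closure Ω) x with hg'
  have hder : ∀ x, HasFDerivAt g (g' x) x := by
    intro x
    by_cases hx : x ∈ Ω
    · rw [hg', indicator_of_mem hx]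
      have h1 := ((hΦ (r x)).comp_hasFDerivAt x (hd hr x hx)).mul (hd hF x hx)
      refine h1.congr_of_eventuallyEq ?_
      filter_upwards [ho.mem_nhds hx] with y hy
      rw [hg, indicator_of_mem hy]; rfl
    · rw [hg', indicator_of_notMem hx]
      have hcl : IsClosed (closure Ω ∩ r ⁻¹' Ici ε) :=
        hr.continuousOn.preimage_isClosed_of_isClosed isClosed_closure isClosed_Ici
      have hxn : x ∉ closure Ω ∩ r ⁻¹' Ici ε := fun h => by
        have := hr0 x ⟨h.1, fun h' => hx (interior_subset h')⟩
        have h2 : ε ≤ r x := h.2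
        linarith
      refine (hasFDerivAt_const (0 : ℝ) x).congr_of_eventuallyEq ?_
      filter_upwards [hcl.isOpen_compl.mem_nhds hxn] with y hy
      rw [hg]
      by_cases hyΩ : y ∈ Ω
      · have : r y ≤ ε := by
          by_contra h
          exact hy ⟨subset_closure hyΩ, (not_le.mp h).le⟩
        rw [indicator_of_mem hyΩ, h0 _ this, zero_mul]
      · rw [indicator_of_notMem hyΩ]
  have hg'v : (fun x => g' x v) = Ω.indicator fun x =>
      φ (r x) * fderivWithin ℝ r (closure Ω) x v * F x
      + Φ (r x) * fderivWithin ℝ F (closure Ω) x v := by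
    ext x
    by_cases hx : x ∈ Ω
    · simp only [hg', indicator_of_mem hx, add_apply, smul_apply, smul_eq_mul]
      ring
    · simp [hg', indicator_of_notMem hx]
  have hrc := hr.continuousOn
  have hFc := hF.continuousOn
  have i1 : Integrable g := by
    rw [hg, integrable_indicator_iff ho.measurableSet]
    exact integrableOn_of_continuousOn_closure hb ((hΦc.comp_continuousOn hrc).mul hFc)
  have i2 : Integrable fun x => g' x v := by
    rw [hg'v, integrable_indicator_iff ho.measurableSet]
    exact integrableOn_of_continuousOn_closure hb ((((hφ.comp_continuousOn hrc).mul (hc hr)).mul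
      hFc).add ((hΦc.comp_continuousOn hrc).mul (hc hF)))
  have := integral_bilinear_hasFDerivAt_right_eq_neg_left_of_integrable (μ := volume)
    (f := fun _ : Fin n → ℝ => (1 : ℝ)) (f' := 0) (g := g) (g' := g') (v := v)
    (B := ContinuousLinearMap.mul ℝ ℝ) (by simp) (by simpa using i2) (by simpa using i1)
    (fun x _ => hasFDerivAt_const _ _) (fun x _ => hder x)
  rw [← integral_indicator ho.measurableSet, ← hg'v]
  simpa using this

section weightedIntegral

variable {n : ℕ} {Ω : Set (Fin n → ℝ)} {r F : (Fin n → ℝ) → ℝ} {p : ℝ}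

lemma nonneg_of_mem_closure (ho : IsOpen Ω) (hpos : ∀ x ∈ Ω, 0 < r x)
    (hr0 : ∀ x ∈ frontier Ω, r x = 0) {x : Fin n → ℝ} (hx : x ∈ closure Ω) : 0 ≤ r x := by
  by_cases h : x ∈ Ω
  · exact (hpos x h).le
  · exact (hr0 x ⟨hx, by rwa [ho.interior_eq]⟩).ge

lemma integrableOn_rpow_mul_fderivWithin_sq (ho : IsOpen Ω) (hb : Bornology.IsBounded Ω)
    (hu : UniqueDiffOn ℝ (closure Ω)) (hr : ContDiffOn ℝ (⊤ : ℕ∞) r (closure Ω))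
    (hpos : ∀ x ∈ Ω, 0 < r x) (hr0 : ∀ x ∈ frontier Ω, r x = 0) (hp : -1 < p) (v : Fin n → ℝ) :
    IntegrableOn (fun x => r x ^ p * fderivWithin ℝ r (closure Ω) x v ^ 2) Ω := by
  have hrc := hr.continuousOn
  have hd := contDiffOn_fderivWithin_apply_const hu hr v
  have hdd := (contDiffOn_fderivWithin_apply_const hu hd v).continuousOn
  set d := fun x => fderivWithin ℝ r (closure Ω) x v
  set dd := fun x => fderivWithin ℝ d (closure Ω) x v
  have hε : ∀ k : ℕ, (0 : ℝ) < 1 / ((k : ℝ) + 1) := fun k => Nat.one_div_pos_of_nat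
  have i1 : ∀ k : ℕ, IntegrableOn (fun x => cutoffPow p (1 / ((k : ℝ) + 1)) (r x) * d x * d x) Ω :=
    fun k => integrableOn_of_continuousOn_closure hb
      ((((continuous_cutoffPow (hε k)).comp_continuousOn hrc).mul hd.continuousOn).mul
        hd.continuousOn)
  have i2 : ∀ k : ℕ, IntegrableOn (fun x => cutoffPrim p (1 / ((k : ℝ) + 1)) (r x) * dd x) Ω :=
    fun k => integrableOn_of_continuousOn_closure hb
      (((continuous_iff_continuousAt.mpr fun t =>
        (hasDerivAt_cutoffPrim (hε k) t).continuousAt).comp_continuousOn hrc).mul hdd)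
  have i3 : IntegrableOn (fun x => r x ^ (p + 1) / (p + 1) * |dd x|) Ω :=
    integrableOn_of_continuousOn_closure hb
      (((hrc.rpow_const fun x _ => Or.inr (by linarith)).div_const _).mul hdd.abs)
  refine integrable_of_tendsto_of_integral_le (C := ∫ x in Ω, r x ^ (p + 1) / (p + 1) * |dd x|)
    (G := fun k x => cutoffPow p (1 / ((k : ℝ) + 1)) (r x) * d x * d x) i1
    (fun k => Eventually.of_forall fun x => ?_) (fun k => ?_) ?_
  · refine (mul_nonneg (cutoffPow_nonneg (p := p) (hε k) (r x)) (mul_self_nonneg (d x))).trans_eq ?_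
    exact (mul_assoc _ _ _).symm
  · have :=
      setIntegral_fderiv_cutoff_eq_zero ho hb hu hr hd hr0
        (hasDerivAt_cutoffPrim (p := p) (hε k)) (continuous_cutoffPow (hε k)) (hε k)
        (fun t ht => cutoffPrim_eq_zero (hε k) ht) v
    rw [integral_add (i1 k) (i2 k)] at this
    rw [eq_neg_of_add_eq_zero_left this, ← integral_neg]
    refine setIntegral_mono_on (i2 k).neg i3 ho.measurableSet fun x hx => ?_
    have h1 := cutoffPrim_le hp (hε k) (hpos x hx).le
    have h2 := cutoffPrim_nonneg (p := p) (hε k) (hpos x hx).le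
    calc -(cutoffPrim p (1 / ((k : ℝ) + 1)) (r x) * dd x)
        = cutoffPrim p (1 / ((k : ℝ) + 1)) (r x) * -dd x := by ring
      _ ≤ cutoffPrim p (1 / ((k : ℝ) + 1)) (r x) * |dd x| := by
          gcongr; exact neg_le_abs _
      _ ≤ _ := by gcongr
  · filter_upwards [ae_restrict_mem ho.measurableSet] with x hx
    simpa only [sq, ← mul_assoc] using ((tendsto_cutoffPow hε
      tendsto_one_div_add_atTop_nhds_zero_nat (hpos x hx)).mul_const (d x)).mul_const (d x)

lemma integrableOn_rpow (ho : IsOpen Ω) (hb : Bornology.IsBounded Ω)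
    (hu : UniqueDiffOn ℝ (closure Ω)) (hr : ContDiffOn ℝ (⊤ : ℕ∞) r (closure Ω))
    (hpos : ∀ x ∈ Ω, 0 < r x) (hr0 : ∀ x ∈ frontier Ω, r x = 0) {c : ℝ} (hc : 0 < c)
    (hgrad : ∀ x ∈ closure Ω,
      c ≤ r x + ∑ i, fderivWithin ℝ r (closure Ω) x (Pi.single i 1) ^ 2) (hp : -1 < p) :
    IntegrableOn (fun x => r x ^ p) Ω := by
  have hrc := hr.continuousOn
  have i1 : IntegrableOn (fun x => r x ^ (p + 1)) Ω := integrableOn_of_continuousOn_closure hb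
    (hrc.rpow_const fun x _ => Or.inr (by linarith))
  have i2 : IntegrableOn (fun x => c⁻¹ * (r x ^ (p + 1)
      + ∑ i, r x ^ p * fderivWithin ℝ r (closure Ω) x (Pi.single i 1) ^ 2)) Ω :=
    (i1.add (integrable_finsetSum _ fun i _ =>
      integrableOn_rpow_mul_fderivWithin_sq ho hb hu hr hpos hr0 hp _)).const_mul _
  refine i2.mono' (((hrc.mono subset_closure).rpow_const
    fun x hx => Or.inl (hpos x hx).ne').aestronglyMeasurable ho.measurableSet) ?_
  filter_upwards [ae_restrict_mem ho.measurableSet] with x hx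
  have h0 := Real.rpow_pos_of_pos (hpos x hx) p
  rw [Real.norm_of_nonneg h0.le, ← Finset.mul_sum, Real.rpow_add_one (hpos x hx).ne', ← mul_add,
    inv_mul_eq_div, le_div_iff₀ hc]
  exact mul_le_mul_of_nonneg_left (hgrad x (subset_closure hx)) h0.le

lemma integrableOn_rpow_mul (ho : IsOpen Ω) (hb : Bornology.IsBounded Ω)
    (h : IntegrableOn (fun x => r x ^ p) Ω) (hF : ContinuousOn F (closure Ω)) :
    IntegrableOn (fun x => r x ^ p * F x) Ω := by
  obtain ⟨C, hC⟩ := hb.isCompact_closure.exists_bound_of_continuousOn hF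
  refine h.mul_bdd (c := C) ((hF.mono subset_closure).aestronglyMeasurable ho.measurableSet) ?_
  filter_upwards [ae_restrict_mem ho.measurableSet] with x hx using hC x (subset_closure hx)

lemma setIntegral_rpow_add_one_mul_fderivWithin (ho : IsOpen Ω) (hb : Bornology.IsBounded Ω)
    (hu : UniqueDiffOn ℝ (closure Ω)) (hr : ContDiffOn ℝ (⊤ : ℕ∞) r (closure Ω))
    (hpos : ∀ x ∈ Ω, 0 < r x) (hr0 : ∀ x ∈ frontier Ω, r x = 0) (hp : -1 < p)
    (hint : IntegrableOn (fun x => r x ^ p) Ω) (hF : ContDiffOn ℝ (⊤ : ℕ∞) F (closure Ω))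
    (v : Fin n → ℝ) :
    ∫ x in Ω, r x ^ (p + 1) * fderivWithin ℝ F (closure Ω) x v
      = -(p + 1) * ∫ x in Ω, r x ^ p * (fderivWithin ℝ r (closure Ω) x v * F x) := by
  have hrc := hr.continuousOn
  have hd := (contDiffOn_fderivWithin_apply_const hu hr v).continuousOn
  have hdF := (contDiffOn_fderivWithin_apply_const hu hF v).continuousOn
  set d := fun x => fderivWithin ℝ r (closure Ω) x v
  set dF := fun x => fderivWithin ℝ F (closure Ω) x v
  have hp' : p + 1 ≠ 0 := by linarith
  have hε : ∀ k : ℕ, (0 : ℝ) < 1 / ((k : ℝ) + 1) := fun k => Nat.one_div_pos_of_nat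
  have i1 : IntegrableOn (fun x => r x ^ p * (d x * F x)) Ω :=
    integrableOn_rpow_mul ho hb hint (hd.mul hF.continuousOn)
  have i2 : IntegrableOn (fun x => r x ^ (p + 1) / (p + 1) * dF x) Ω :=
    integrableOn_of_continuousOn_closure hb
      (((hrc.rpow_const fun x _ => Or.inr (by linarith)).div_const _).mul hdF)
  have hlim : Tendsto (fun k : ℕ => ∫ x in Ω, (cutoffPow p (1 / ((k : ℝ) + 1)) (r x) * d x * F x
      + cutoffPrim p (1 / ((k : ℝ) + 1)) (r x) * dF x)) atTop
      (𝓝 (∫ x in Ω, (r x ^ p * (d x * F x) + r x ^ (p + 1) / (p + 1) * dF x))) := by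
    refine tendsto_integral_of_dominated_convergence
      (fun x => |r x ^ p * (d x * F x)| + |r x ^ (p + 1) / (p + 1) * dF x|) (fun k => ?_)
      (i1.abs.add i2.abs) (fun k => ?_) ?_
    · refine ContinuousOn.aestronglyMeasurable ?_ ho.measurableSet
      refine ContinuousOn.mono ?_ subset_closure
      exact ((((continuous_cutoffPow (hε k)).comp_continuousOn hrc).mul hd).mul
        hF.continuousOn).add (((continuous_iff_continuousAt.mpr fun t =>
        (hasDerivAt_cutoffPrim (hε k) t).continuousAt).comp_continuousOn hrc).mul hdF)
    · filter_upwards [ae_restrict_mem ho.measurableSet] with x hx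
      have hx0 := hpos x hx
      refine (norm_add_le _ _).trans (add_le_add ?_ ?_)
      · rw [mul_assoc, Real.norm_eq_abs, abs_mul, abs_mul (r x ^ p),
          abs_of_nonneg (cutoffPow_nonneg (hε k) _), abs_of_nonneg (Real.rpow_nonneg hx0.le _)]
        exact mul_le_mul_of_nonneg_right (cutoffPow_le (hε k) hx0) (abs_nonneg _)
      · rw [Real.norm_eq_abs, abs_mul, abs_mul (r x ^ (p + 1) / (p + 1)),
          abs_of_nonneg (cutoffPrim_nonneg (hε k) hx0.le)]
        exact mul_le_mul_of_nonneg_right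
          ((cutoffPrim_le hp (hε k) hx0.le).trans (le_abs_self _)) (abs_nonneg _)
    · filter_upwards [ae_restrict_mem ho.measurableSet] with x hx
      rw [← mul_assoc]
      exact (((tendsto_cutoffPow hε tendsto_one_div_add_atTop_nhds_zero_nat
        (hpos x hx)).mul_const _).mul_const _).add ((tendsto_cutoffPrim hp hε
        tendsto_one_div_add_atTop_nhds_zero_nat (hpos x hx).le).mul_const _)
  have h0 : ∀ k : ℕ, ∫ x in Ω, (cutoffPow p (1 / ((k : ℝ) + 1)) (r x) * d x * F x
      + cutoffPrim p (1 / ((k : ℝ) + 1)) (r x) * dF x) = 0 := fun k =>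
    setIntegral_fderiv_cutoff_eq_zero ho hb hu hr hF hr0
      (hasDerivAt_cutoffPrim (p := p) (hε k)) (continuous_cutoffPow (hε k)) (hε k)
      (fun t ht => cutoffPrim_eq_zero (hε k) ht) v
  simp only [h0] at hlim
  have key := tendsto_nhds_unique hlim tendsto_const_nhds
  rw [integral_add i1 i2] at key
  have h1 : ∫ x in Ω, r x ^ (p + 1) / (p + 1) * dF x
      = (p + 1)⁻¹ * ∫ x in Ω, r x ^ (p + 1) * dF x := by
    rw [← integral_const_mul]
    congr 1 with x
    ring
  rw [h1] at key
  change ∫ x in Ω, r x ^ (p + 1) * dF x = -(p + 1) * ∫ x in Ω, r x ^ p * (d x * F x)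
  rw [eq_neg_of_add_eq_zero_left key, neg_mul_neg, mul_inv_cancel_left₀ hp']

lemma exists_pos_le_add_fderivWithin_sq (ho : IsOpen Ω) (hb : Bornology.IsBounded Ω)
    (hu : UniqueDiffOn ℝ (closure Ω)) (hr : ContDiffOn ℝ (⊤ : ℕ∞) r (closure Ω))
    (hpos : ∀ x ∈ Ω, 0 < r x) (hr0 : ∀ x ∈ frontier Ω, r x = 0)
    (hgrad : ∀ x ∈ frontier Ω, fderiv ℝ r x ≠ 0) :
    ∃ c > 0, ∀ x ∈ closure Ω,
      c ≤ r x + ∑ i, fderivWithin ℝ r (closure Ω) x (Pi.single i 1) ^ 2 := by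
  refine hb.isCompact_closure.exists_forall_le' (a := 0) ?_ fun x hx => ?_
  · exact hr.continuousOn.add (continuousOn_finsetSum _ fun i _ =>
      (contDiffOn_fderivWithin_apply_const hu hr _).continuousOn.pow 2)
  · by_cases hxΩ : x ∈ Ω
    · exact add_pos_of_pos_of_nonneg (hpos x hxΩ) (Finset.sum_nonneg fun i _ => sq_nonneg _)
    have hxf : x ∈ frontier Ω := ⟨hx, by rwa [ho.interior_eq]⟩
    have hne := hgrad x hxf
    have hdiff : DifferentiableAt ℝ r x := by
      by_contra h
      exact hne (fderiv_zero_of_not_differentiableAt h)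
    rw [hr0 x hxf, zero_add, hdiff.fderivWithin (hu x hx)]
    refine (Finset.sum_nonneg fun i _ => sq_nonneg _).lt_of_ne fun h => hne ?_
    have h' := (Finset.sum_eq_zero_iff_of_nonneg fun i _ => sq_nonneg _).mp h.symm
    refine ContinuousLinearMap.coe_injective (LinearMap.pi_ext' fun i => LinearMap.ext_ring ?_)
    simpa using h' i (Finset.mem_univ i)

end weightedIntegral

/-- The evaluation homomorphism at a point. -/
def smoothAlgebraEval {n : ℕ} (K : Set (Fin n → ℝ)) (x : Fin n → ℝ) : smoothAlgebra K →ₐ[ℝ] ℝ :=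
  (Pi.evalAlgHom ℝ (fun _ : Fin n → ℝ => ℝ) x).comp (smoothAlgebra K).val

/-- Integration against the weight `r ^ p`, for the exponents `p > -1` of interest. -/
noncomputable def weightedIntegral {n : ℕ} {Ω : Set (Fin n → ℝ)} (ho : IsOpen Ω)
    (hb : Bornology.IsBounded Ω) (r : (Fin n → ℝ) → ℝ)
    (hint : ∀ p : ℝ, -1 < p → IntegrableOn (fun x => r x ^ p) Ω) (p : ℝ) :
    smoothAlgebra (closure Ω) →ₗ[ℝ] ℝ :=
  if hp : -1 < p then
    { toFun := fun F => ∫ x in Ω, r x ^ p * F.1 x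
      map_add' := fun F F' => by
        rw [← integral_add (integrableOn_rpow_mul ho hb (hint p hp) (ContDiffOn.continuousOn F.2))
          (integrableOn_rpow_mul ho hb (hint p hp) (ContDiffOn.continuousOn F'.2))]
        simp [mul_add]
      map_smul' := fun c F => by
        rw [RingHom.id_apply, smul_eq_mul, ← integral_const_mul]
        simp [mul_left_comm] }
  else 0

lemma weightedIntegral_apply {n : ℕ} {Ω : Set (Fin n → ℝ)} (ho : IsOpen Ω)
    (hb : Bornology.IsBounded Ω) (r : (Fin n → ℝ) → ℝ)
    (hint : ∀ p : ℝ, -1 < p → IntegrableOn (fun x => r x ^ p) Ω) {p : ℝ} (hp : -1 < p)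
    (F : smoothAlgebra (closure Ω)) :
    weightedIntegral ho hb r hint p F = ∫ x in Ω, r x ^ p * F.1 x := by
  rw [weightedIntegral, dif_pos hp]; rfl

/-- The weighted calculus on the closure of a bounded open set, with weight a defining function
`r` of the set. -/
noncomputable def closureCalculus {n : ℕ} {Ω : Set (Fin n → ℝ)} (ho : IsOpen Ω)
    (hb : Bornology.IsBounded Ω) (hu : UniqueDiffOn ℝ (closure Ω)) {r : (Fin n → ℝ) → ℝ}
    (hr : ContDiffOn ℝ (⊤ : ℕ∞) r (closure Ω))
    (hpos : ∀ x ∈ Ω, 0 < r x) (hr0 : ∀ x ∈ frontier Ω, r x = 0)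
    (hgrad : ∃ c > 0, ∀ x ∈ closure Ω,
      c ≤ r x + ∑ i, fderivWithin ℝ r (closure Ω) x (Pi.single i 1) ^ 2)
    (G : Fin n → Fin n → smoothAlgebra (closure Ω)) (hGs : ∀ i j, G i j = G j i)
    (hGe : ∃ c > 0, ∀ x ∈ closure Ω, ∀ ξ : Fin n → ℝ,
      c * ∑ i, ξ i ^ 2 ≤ ∑ i, ∑ j, (G i j).1 x * ξ i * ξ j) :
    WeightedCalculus (smoothAlgebra (closure Ω)) (closure Ω) (Fin n) :=
  have hint : ∀ p : ℝ, -1 < p → IntegrableOn (fun x => r x ^ p) Ω := fun _ hp =>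
    let ⟨_, hc, h⟩ := hgrad
    integrableOn_rpow ho hb hu hr hpos hr0 hc h hp
  { ev := fun x => smoothAlgebraEval (closure Ω) x
    bdd := fun g => by
      obtain ⟨C, hC⟩ := hb.isCompact_closure.exists_bound_of_continuousOn
        (ContDiffOn.continuousOn g.2)
      exact ⟨C, fun x => hC x x.2⟩
    d := smoothDerivation isClosed_closure hu
    d_comm := smoothDerivation_comm isClosed_closure hu
      (closure_mono (interior_maximal subset_closure ho))
    r := ⟨r, hr⟩
    r_nonneg := fun x => nonneg_of_mem_closure ho hpos hr0 x.2
    I := weightedIntegral ho hb r hint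
    I_nonneg := fun p hp g hg => by
      rw [weightedIntegral_apply ho hb r hint hp]
      exact setIntegral_nonneg ho.measurableSet fun x hx =>
        mul_nonneg (Real.rpow_nonneg (hpos x hx).le _) (hg ⟨x, subset_closure hx⟩)
    I_mul_r := fun p hp g => by
      rw [weightedIntegral_apply ho hb r hint hp,
        weightedIntegral_apply ho hb r hint (by linarith)]
      refine setIntegral_congr_fun ho.measurableSet fun x hx => ?_
      change r x ^ p * (r x * g.1 x) = r x ^ (p + 1) * g.1 x
      rw [Real.rpow_add_one (hpos x hx).ne', mul_assoc]
    I_parts := fun p hp i g => by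
      rw [weightedIntegral_apply ho hb r hint hp,
        weightedIntegral_apply ho hb r hint (by linarith)]
      exact setIntegral_rpow_add_one_mul_fderivWithin ho hb hu hr hpos hr0 hp (hint p hp) g.2 _
    grad_r := hgrad.imp fun c h => ⟨h.1, fun x => h.2 x x.2⟩
    G := G
    G_symm := hGs
    G_elliptic := hGe.imp fun c h => ⟨h.1, fun x => h.2 x x.2⟩ }

section partialDerivatives

variable {n : ℕ} {Ω : Set (Fin n → ℝ)}

lemma pd_eqOn (ho : IsOpen Ω) {f g : (Fin n → ℝ) → ℝ} (h : EqOn f g Ω) (i : Fin n) :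
    EqOn (pd i f) (pd i g) Ω := fun x hx => by
  rw [pd, pd, (h.eventuallyEq_of_mem (ho.mem_nhds hx)).fderiv_eq]

lemma fderivWithin_closure_eqOn_pd (ho : IsOpen Ω) (f : (Fin n → ℝ) → ℝ) (i : Fin n) :
    EqOn (fun x => fderivWithin ℝ f (closure Ω) x (Pi.single i 1)) (pd i f) Ω := fun x hx => by
  simp only [pd]
  rw [fderivWithin_of_mem_nhds (mem_of_superset (ho.mem_nhds hx) subset_closure)]

lemma differentiableAt_of_mem_smoothAlgebra (ho : IsOpen Ω) (F : smoothAlgebra (closure Ω))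
    {x : Fin n → ℝ} (hx : x ∈ Ω) : DifferentiableAt ℝ F.1 x :=
  (ContDiffOn.differentiableOn F.2 (by simp)).differentiableAt
    (mem_of_superset (ho.mem_nhds hx) subset_closure)

lemma pd_rpow_mul (ho : IsOpen Ω) (α : ℝ) (r h : smoothAlgebra (closure Ω)) {x : Fin n → ℝ}
    (hx : x ∈ Ω) (hr : 0 < r.1 x) (i : Fin n) :
    r.1 x ^ (1 - α) * pd i (fun y => r.1 y ^ α * h.1 y) x
      = r.1 x * pd i h.1 x + α * (pd i r.1 x * h.1 x) := by
  have hd := ((differentiableAt_of_mem_smoothAlgebra ho r hx).hasFDerivAt.rpow_const (p := α)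
    (Or.inl hr.ne')).mul (differentiableAt_of_mem_smoothAlgebra ho h hx).hasFDerivAt
  have h1 : r.1 x ^ (1 - α) * r.1 x ^ α = r.1 x := by
    rw [← Real.rpow_add hr, sub_add_cancel, Real.rpow_one]
  have h2 : r.1 x ^ (1 - α) * r.1 x ^ (α - 1) = 1 := by
    rw [← Real.rpow_add hr, sub_add_sub_cancel, sub_self, Real.rpow_zero]
  have h3 : pd i (fun y => r.1 y ^ α * h.1 y) x = _ :=
    congrArg (fun L : (Fin n → ℝ) →L[ℝ] ℝ => L (Pi.single i 1)) hd.fderiv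
  rw [h3]
  simp only [pd, add_apply, smul_apply, smul_eq_mul]
  linear_combination (fderiv ℝ h.1 x (Pi.single i 1)) * h1
    + α * (fderiv ℝ r.1 x (Pi.single i 1)) * h.1 x * h2

end partialDerivatives

lemma sum_Hcoef_mul_ge (u : (Fin 3 → ℝ) → Fin 4 → ℝ) {x : Fin 3 → ℝ} (h0 : 0 < u x 0)
    (h1 : -(u x 0) ^ 2 + (u x 1) ^ 2 + (u x 2) ^ 2 + (u x 3) ^ 2 = -1) (ξ : Fin 3 → ℝ) :
    (u x 0 ^ 2)⁻¹ * ∑ i, ξ i ^ 2 ≤ ∑ i, ∑ j, Hcoef u i j x * ξ i * ξ j := by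
  have e : ∑ i, ∑ j, Hcoef u i j x * ξ i * ξ j = (u x 0 ^ 2)⁻¹ *
      (u x 0 ^ 2 * ∑ i, ξ i ^ 2 - (u x 1 * ξ 0 + u x 2 * ξ 1 + u x 3 * ξ 2) ^ 2) := by
    have s0 : (0 : Fin 3).succ = (1 : Fin 4) := rfl
    have s1 : (1 : Fin 3).succ = (2 : Fin 4) := rfl
    have s2 : (2 : Fin 3).succ = (3 : Fin 4) := rfl
    simp only [Fin.sum_univ_three, Hcoef, s0, s1, s2]
    simp
    field_simp
    ring
  rw [e]
  refine mul_le_mul_of_nonneg_left ?_ (by positivity)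
  simp only [Fin.sum_univ_three]
  have : u x 0 ^ 2 = 1 + u x 1 ^ 2 + u x 2 ^ 2 + u x 3 ^ 2 := by linarith
  rw [this]
  nlinarith [sq_nonneg (u x 1 * ξ 1 - u x 2 * ξ 0), sq_nonneg (u x 1 * ξ 2 - u x 3 * ξ 0),
    sq_nonneg (u x 2 * ξ 2 - u x 3 * ξ 1)]

section closureCalculus

variable {n : ℕ} {Ω : Set (Fin n → ℝ)} {ho : IsOpen Ω} {hb : Bornology.IsBounded Ω}
  {hu : UniqueDiffOn ℝ (closure Ω)} {r : (Fin n → ℝ) → ℝ}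
  {hr : ContDiffOn ℝ (⊤ : ℕ∞) r (closure Ω)}
  {hpos : ∀ x ∈ Ω, 0 < r x} {hr0 : ∀ x ∈ frontier Ω, r x = 0}
  {hgrad : ∃ c > 0, ∀ x ∈ closure Ω,
    c ≤ r x + ∑ i, fderivWithin ℝ r (closure Ω) x (Pi.single i 1) ^ 2}
  {G : Fin n → Fin n → smoothAlgebra (closure Ω)} {hGs : ∀ i j, G i j = G j i}
  {hGe : ∃ c > 0, ∀ x ∈ closure Ω, ∀ ξ : Fin n → ℝ,
    c * ∑ i, ξ i ^ 2 ≤ ∑ i, ∑ j, (G i j).1 x * ξ i * ξ j}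

lemma closureCalculus_I_apply {p : ℝ} (hp : -1 < p) (F : smoothAlgebra (closure Ω)) :
    (closureCalculus ho hb hu hr hpos hr0 hgrad G hGs hGe).I p F = ∫ x in Ω, r x ^ p * F.1 x :=
  weightedIntegral_apply ho hb r (fun _ hq => hgrad.elim fun _ h =>
    integrableOn_rpow ho hb hu hr hpos hr0 h.1 h.2 hq) hp F

lemma closureCalculus_word_apply (w : List (Fin n)) {f : (Fin n → ℝ) → ℝ}
    {F : smoothAlgebra (closure Ω)} (h : EqOn f F.1 Ω) :
    EqOn (w.foldr pd f)
      ((closureCalculus ho hb hu hr hpos hr0 hgrad G hGs hGe).word w F).1 Ω := by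
  induction w with
  | nil => exact h
  | cons i w ih =>
    rw [List.foldr_cons, WeightedCalculus.word_cons]
    exact (pd_eqOn ho ih i).trans fun x hx =>
      (fderivWithin_closure_eqOn_pd ho _ i hx).symm

lemma closureCalculus_I_word_sq {p : ℝ} (hp : -1 < p) {k : ℕ} (b : Fin k → Fin n)
    {f : (Fin n → ℝ) → ℝ} {F : smoothAlgebra (closure Ω)} (h : EqOn f F.1 Ω) :
    (closureCalculus ho hb hu hr hpos hr0 hgrad G hGs hGe).I p
      ((closureCalculus ho hb hu hr hpos hr0 hgrad G hGs hGe).word (List.ofFn b) F ^ 2)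
      = ∫ x in Ω, r x ^ p * mderiv b f x ^ 2 := by
  rw [closureCalculus_I_apply hp]
  refine setIntegral_congr_fun ho.measurableSet fun x hx => ?_
  rw [mderiv, closureCalculus_word_apply (ho := ho) (hb := hb) (hu := hu) (hr := hr)
    (hpos := hpos) (hr0 := hr0) (hgrad := hgrad) (hGs := hGs) (hGe := hGe) (List.ofFn b) h hx]
  rfl

end closureCalculus

lemma smoothAlgebra_coe_sum {n : ℕ} {K : Set (Fin n → ℝ)} {ι : Type*} (s : Finset ι)
    (F : ι → smoothAlgebra K) (x : Fin n → ℝ) : (∑ i ∈ s, F i).1 x = ∑ i ∈ s, (F i).1 x := by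
  simp

lemma Aop_add_self_eqOn {Ω : Set (Fin 3 → ℝ)} {ho : IsOpen Ω} {hb : Bornology.IsBounded Ω}
    {hu : UniqueDiffOn ℝ (closure Ω)} {r : (Fin 3 → ℝ) → ℝ}
    {hr : ContDiffOn ℝ (⊤ : ℕ∞) r (closure Ω)}
    {hpos : ∀ x ∈ Ω, 0 < r x} {hr0 : ∀ x ∈ frontier Ω, r x = 0}
    {hgrad : ∃ c > 0, ∀ x ∈ closure Ω,
      c ≤ r x + ∑ i, fderivWithin ℝ r (closure Ω) x (Pi.single i 1) ^ 2}
    {κ : ℝ} {u : (Fin 3 → ℝ) → Fin 4 → ℝ} {H : Fin 3 → Fin 3 → smoothAlgebra (closure Ω)}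
    (hH : ∀ i j, (H i j).1 = Hcoef u i j) {hGs : ∀ i j, (κ + 1) • H i j = (κ + 1) • H j i}
    {hGe : ∃ c > 0, ∀ x ∈ closure Ω, ∀ ξ : Fin 3 → ℝ,
      c * ∑ i, ξ i ^ 2 ≤ ∑ i, ∑ j, ((κ + 1) • H i j).1 x * ξ i * ξ j}
    (F : smoothAlgebra (closure Ω)) :
    EqOn (fun x => Aop κ r u F.1 x + F.1 x) (F - (closureCalculus ho hb hu hr hpos hr0 hgrad
      (fun i j => (κ + 1) • H i j) hGs hGe).M (1 / κ) F).1 Ω := by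
  intro x hx
  set W := closureCalculus ho hb hu hr hpos hr0 hgrad (fun i j => (κ + 1) • H i j) hGs hGe with hW
  set h : Fin 3 → smoothAlgebra (closure Ω) := fun i => ∑ j, H i j * W.d j F with hh
  have hflux : ∀ i, W.flux i F = (κ + 1) • h i := fun i => by
    rw [W.flux_apply, hh, Finset.smul_sum]
    exact Finset.sum_congr rfl fun j _ => smul_mul_assoc _ _ _
  have hpd : ∀ i, pd i (fun y => r y ^ (1 / κ) * ∑ j, Hcoef u i j y * pd j F.1 y) x
      = pd i (fun y => r y ^ (1 / κ) * (h i).1 y) x := fun i => by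
    refine pd_eqOn ho (fun y hy => ?_) i hx
    simp only [hh, smoothAlgebra_coe_sum]
    congr 1
    refine Finset.sum_congr rfl fun j _ => ?_
    rw [← hH, ← fderivWithin_closure_eqOn_pd ho F.1 j hy]
    rfl
  have hM : (W.M (1 / κ) F).1 x
      = (κ + 1) * ∑ i, (r x * pd i (h i).1 x + 1 / κ * (pd i r x * (h i).1 x)) := by
    have e : W.M (1 / κ) F = (κ + 1) • ∑ i, (W.r * W.d i (h i) + (1 / κ) • (W.d i W.r * h i)) := by
      simp only [W.M_apply, W.divFlux_apply, W.N_apply, hflux, Derivation.map_smul, mul_smul_comm,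
        Finset.mul_sum, Finset.smul_sum, Finset.sum_add_distrib, smul_add]
      congr 1
      exact Finset.sum_congr rfl fun i _ => smul_comm _ _ _
    rw [e]
    change (κ + 1) * (∑ i, (W.r * W.d i (h i) + (1 / κ) • (W.d i W.r * h i))).1 x = _
    rw [smoothAlgebra_coe_sum]
    congr 1
    refine Finset.sum_congr rfl fun i _ => ?_
    rw [← fderivWithin_closure_eqOn_pd ho (h i).1 i hx, ← fderivWithin_closure_eqOn_pd ho r i hx]
    rfl
  change Aop κ r u F.1 x + F.1 x = F.1 x - (W.M (1 / κ) F).1 x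
  rw [hM, Aop, mul_assoc, Finset.mul_sum]
  have hsum := Finset.sum_congr rfl fun i (_ : i ∈ Finset.univ) =>
    (congrArg (r x ^ ((1 : ℝ) - 1 / κ) * ·) (hpd i)).trans
      (pd_rpow_mul ho (1 / κ) ⟨r, hr⟩ (h i) hx (hpos x hx) i)
  rw [hsum]
  ring

/-- **High-order invertible weighted elliptic estimate** (Corollary 3.13 of the paper): for
every integer `l ≥ 1`, `‖f‖_{H^{2l,1/(2κ)+l-1/2}} ≲ ‖(A + I) f‖_{H^{2l-2,1/(2κ)+l-3/2}}`. -/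
theorem high_order_elliptic_estimate_A_plus_I (Ω : Set (Fin 3 → ℝ))
    (hΩo : IsOpen Ω) (hΩb : Bornology.IsBounded Ω) (hΩs : HasSmoothBoundary Ω)
    (κ : ℝ) (hκ : 0 < κ)
    (r : (Fin 3 → ℝ) → ℝ) (hr : ContDiffOn ℝ (⊤ : ℕ∞) r (closure Ω))
    (hrpos : ∀ x ∈ Ω, 0 < r x) (hr0 : ∀ x ∈ frontier Ω, r x = 0)
    (hrgrad : ∀ x ∈ frontier Ω, fderiv ℝ r x ≠ 0)
    (u : (Fin 3 → ℝ) → Fin 4 → ℝ)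
    (hu : ∀ α, ContDiffOn ℝ (⊤ : ℕ∞) (fun x => u x α) (closure Ω))
    (hu0 : ∀ x ∈ closure Ω, 0 < u x 0)
    (hunorm : ∀ x ∈ closure Ω,
      -(u x 0) ^ 2 + (u x 1) ^ 2 + (u x 2) ^ 2 + (u x 3) ^ 2 = -1) :
    ∀ l : ℕ, 1 ≤ l → ∃ C > 0, ∀ f : (Fin 3 → ℝ) → ℝ,
      ContDiffOn ℝ (⊤ : ℕ∞) f (closure Ω) →
      rSobNorm Ω r (2*l) (1/(2*κ) + l - 1/2) f
        ≤ C * rSobNorm Ω r (2*l - 2) (1/(2*κ) + l - 3/2)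
            (fun x => Aop κ r u f x + f x) := by
  have hdiff := hΩs.uniqueDiffOn_closure hΩo
  have hgrad := exists_pos_le_add_fderivWithin_sq hΩo hΩb hdiff hr hrpos hr0 hrgrad
  let H : Fin 3 → Fin 3 → smoothAlgebra (closure Ω) := fun i j =>
    ⟨Hcoef u i j, contDiffOn_const.sub (((hu i.succ).mul (hu j.succ)).div ((hu 0).pow 2)
      fun x hx => (pow_pos (hu0 x hx) 2).ne')⟩
  have hGs : ∀ i j, (κ + 1) • H i j = (κ + 1) • H j i := fun i j => by
    congr 1
    ext x
    simp only [H, Hcoef, eq_comm (a := i), mul_comm (u x i.succ)]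
  have hGe : ∃ c > 0, ∀ x ∈ closure Ω, ∀ ξ : Fin 3 → ℝ,
      c * ∑ i, ξ i ^ 2 ≤ ∑ i, ∑ j, ((κ + 1) • H i j).1 x * ξ i * ξ j := by
    obtain ⟨c, hc, hle⟩ := hΩb.isCompact_closure.exists_forall_le' (a := 0)
      (f := fun x => (κ + 1) * (u x 0 ^ 2)⁻¹)
      (continuousOn_const.mul (((hu 0).continuousOn.pow 2).inv₀
        fun x hx => (pow_pos (hu0 x hx) 2).ne'))
      fun x hx => mul_pos (by linarith) (inv_pos.mpr (pow_pos (hu0 x hx) 2))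
    refine ⟨c, hc, fun x hx ξ => ?_⟩
    calc c * ∑ i, ξ i ^ 2 ≤ (κ + 1) * (u x 0 ^ 2)⁻¹ * ∑ i, ξ i ^ 2 :=
          mul_le_mul_of_nonneg_right (hle x hx) (Finset.sum_nonneg fun i _ => sq_nonneg _)
      _ ≤ (κ + 1) * ∑ i, ∑ j, Hcoef u i j x * ξ i * ξ j := by
          rw [mul_assoc]
          exact mul_le_mul_of_nonneg_left (sum_Hcoef_mul_ge u (hu0 x hx) (hunorm x hx) ξ)
            (by linarith)
      _ = ∑ i, ∑ j, ((κ + 1) • H i j).1 x * ξ i * ξ j := by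
          simp only [Finset.mul_sum, ← mul_assoc]
          rfl
  intro l hl
  obtain ⟨n, rfl⟩ := Nat.exists_eq_add_of_le' hl
  have hα : 0 < 1 / κ := one_div_pos.mpr hκ
  obtain ⟨C, hC, hCle⟩ := (closureCalculus hΩo hΩb hdiff hr hrpos hr0 hgrad
    (fun i j => (κ + 1) • H i j) hGs hGe).high_order_estimate hα n
  refine ⟨√C, Real.sqrt_pos.mpr hC, fun f hf => ?_⟩
  have h1 : 2 * (1 / (2 * κ) + ((n + 1 : ℕ) : ℝ) - 1 / 2) = 1 / κ - 1 + 2 * (n + 1 : ℕ) := by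
    field_simp
    ring
  have h2 : 2 * (1 / (2 * κ) + ((n + 1 : ℕ) : ℝ) - 3 / 2) = 1 / κ - 1 + 2 * n := by
    push_cast
    field_simp
    ring
  have hp : ∀ m : ℕ, -1 < 1 / κ - 1 + 2 * (m : ℝ) := fun m => by
    linarith [m.cast_nonneg (α := ℝ)]
  rw [rSobNorm, rSobNorm, ← Real.sqrt_mul hC.le, h1, h2]
  refine Real.sqrt_le_sqrt ?_
  have key := hCle ⟨f, hf⟩
  have e1 : 2 * (n + 1) + 1 = 2 * n + 3 := by ring
  have e2 : 2 * (n + 1) - 2 + 1 = 2 * n + 1 := by omega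
  rw [e1, e2]
  convert key using 5 with k _ b _ k _ b _
  · exact (closureCalculus_I_word_sq (hp _) b (F := ⟨f, hf⟩) fun x _ => rfl).symm
  · exact (closureCalculus_I_word_sq (hp _) b (Aop_add_self_eqOn (fun _ _ => rfl) ⟨f, hf⟩)).symm
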